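/- There is a uGF(2) ontology O (using three variables) that is materializable but does not admit hom-universal models: for the instance D = {C(a)} there is no model B of O and D with a homomorphism preserving dom(D) into every model of O and D, yet every instance consistent with O has a CQ-materialization and CQ-evaluation w.r.t. O is in PTime. -/

import Mathlib

/-- A relational signature. -/
structure Sig where
  Rel : Type
  ar : Rel → ℕ

/-- A relational atom (fact) over the signature `σ` with arguments in `V`. -/
abbrev Atm (σ : Sig) (V : Type) : Type := (R : σ.Rel) × (Fin (σ.ar R) → V)

/-- An interpretation (or instance): a set of facts. -/
abbrev Interp (σ : Sig) (V : Type) : Type := Set (Atm σ V)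

/-- The domain of an interpretation: the elements occurring in some fact. -/
def Interp.dom {σ : Sig} {V : Type} (A : Interp σ V) : Set V :=
  { v | ∃ f ∈ A, ∃ i, f.2 i = v }

/-- `h` is a homomorphism from `A` to `B`. -/
def IsHom {σ : Sig} {V W : Type} (A : Interp σ V) (B : Interp σ W) (h : V → W) : Prop :=
  ∀ f ∈ A, (⟨f.1, h ∘ f.2⟩ : Atm σ W) ∈ B

/-- An ontology, given semantically as the class of its models. -/
def Ont (σ : Sig) : Type 1 := ∀ W : Type, Interp σ W → Prop

/-- `(W, ι, B)` is a model of the ontology `O` and the instance `D` (with standard names: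
`ι` injective, and every fact of `D` holds in `B`). -/
def IsMod {σ : Sig} (O : Ont σ) {V W : Type} (D : Interp σ V) (ι : V → W)
    (B : Interp σ W) : Prop :=
  Function.Injective ι ∧ IsHom D B ι ∧ O W B

/-- A conjunctive query of arity `k`, given by its finite canonical database together with
the tuple of answer variables. -/
structure CQ (σ : Sig) (k : ℕ) where
  V : Type
  finV : Finite V
  facts : Interp σ V
  finFacts : facts.Finite
  ans : Fin k → V

/-- `t` is an answer to the CQ `q` in `B`. -/
def CQAns {σ : Sig} {k : ℕ} {W : Type} (B : Interp σ W) (q : CQ σ k)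
    (t : Fin k → W) : Prop :=
  ∃ h : q.V → W, IsHom q.facts B h ∧ h ∘ q.ans = t

/-- A union of conjunctive queries. -/
abbrev UCQ (σ : Sig) (k : ℕ) := List (CQ σ k)

/-- `t` is an answer to the UCQ `qs` in `B`. -/
def UCQAns {σ : Sig} {k : ℕ} {W : Type} (B : Interp σ W) (qs : UCQ σ k)
    (t : Fin k → W) : Prop :=
  ∃ q ∈ qs, CQAns B q t

/-- `a` is a certain answer to the CQ `q` on `D` given `O`. -/
def CertainCQ {σ : Sig} (O : Ont σ) {V : Type} {k : ℕ} (D : Interp σ V) (q : CQ σ k)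
    (a : Fin k → V) : Prop :=
  ∀ (W : Type) (ι : V → W) (B : Interp σ W), IsMod O D ι B → CQAns B q (ι ∘ a)

/-- `a` is a certain answer to the UCQ `qs` on `D` given `O`. -/
def CertainUCQ {σ : Sig} (O : Ont σ) {V : Type} {k : ℕ} (D : Interp σ V) (qs : UCQ σ k)
    (a : Fin k → V) : Prop :=
  ∀ (W : Type) (ι : V → W) (B : Interp σ W), IsMod O D ι B → UCQAns B qs (ι ∘ a)

/-- `D` is consistent w.r.t. `O`. -/
def Consistent {σ : Sig} (O : Ont σ) {V : Type} (D : Interp σ V) : Prop :=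
  ∃ (W : Type) (ι : V → W) (B : Interp σ W), IsMod O D ι B

/-- `(W, ι, B)` is a materialization of `O` and `D`: a model in which, for every union of
conjunctive queries and every tuple over the domain of `D`, the answers are exactly the
certain answers. -/
def IsMat {σ : Sig} (O : Ont σ) {V W : Type} (D : Interp σ V) (ι : V → W)
    (B : Interp σ W) : Prop :=
  IsMod O D ι B ∧ ∀ (k : ℕ) (qs : UCQ σ k) (a : Fin k → V), (∀ i, a i ∈ D.dom) →
    (UCQAns B qs (ι ∘ a) ↔ CertainUCQ O D qs a)
/-- A non-deterministic Turing machine with a single one-sided infinite tape.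
`δ q a` is the set of transitions `(q', b, dir)` available in state `q` reading `a`
(`dir = true` means move right, `dir = false` move left). -/
structure NTM where
  Q : Type
  A : Type
  finQ : Finite Q
  finA : Finite A
  blank : A
  q0 : Q
  qa : Q
  δ : Q → A → Set (Q × A × Bool)

namespace NTM

/-- Symbols occurring in the string representation `vqw` of configurations. -/
abbrev Sym (M : NTM) : Type := M.Q ⊕ M.A

variable (M : NTM)

/-- One computation step on string representations of configurations (length preserving). -/
inductive Step : List M.Sym → List M.Sym → Prop
  | right (u v : List M.Sym) (q q' : M.Q) (a b : M.A)
      (h : (q', b, true) ∈ M.δ q a) :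
      Step (u ++ [Sum.inl q, Sum.inr a] ++ v) (u ++ [Sum.inr b, Sum.inl q'] ++ v)
  | left (u v : List M.Sym) (q q' : M.Q) (a b c : M.A)
      (h : (q', b, false) ∈ M.δ q a) :
      Step (u ++ [Sum.inr c, Sum.inl q, Sum.inr a] ++ v)
           (u ++ [Sum.inl q', Sum.inr c, Sum.inr b] ++ v)

/-- A string over `Sym` is a configuration if it contains exactly one state symbol. -/
def IsConfig (l : List M.Sym) : Prop := (l.filter Sum.isLeft).length = 1

/-- A run of `M`: a nonempty sequence of configurations, each obtained from the previous
one by a computation step (all configurations have the same length). -/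
def IsRun (cs : List (List M.Sym)) : Prop :=
  cs ≠ [] ∧ (∀ c ∈ cs, M.IsConfig c) ∧ cs.Chain' M.Step

/-- A run is accepting if its last configuration contains the accepting state. -/
def Accepting (cs : List (List M.Sym)) : Prop :=
  ∃ c, cs.getLast? = some c ∧ Sum.inl M.qa ∈ c

/-- A partial configuration: a string over `Sym ∪ {⋆}` (`⋆ = none`) with at most one
state symbol. -/
def IsPConfig (l : List (Option M.Sym)) : Prop :=
  (l.filter fun s => (s.map Sum.isLeft).getD false).length ≤ 1

/-- A configuration matches a partial configuration if they have the same length and agree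
on all non-wildcard positions. -/
def MatchesC (c : List M.Sym) (p : List (Option M.Sym)) : Prop :=
  List.Forall₂ (fun s o => ∀ s' : M.Sym, o = some s' → s' = s) c p

/-- A partial run: a nonempty sequence of partial configurations of equal length whose first
element starts with the initial state and contains no other state symbol. -/
def IsPRun (ps : List (List (Option M.Sym))) : Prop :=
  ps ≠ [] ∧ (∀ p ∈ ps, M.IsPConfig p) ∧ (∀ p ∈ ps, ∀ p' ∈ ps, p.length = p'.length) ∧
  ∃ rest, ps.head? = some (some (Sum.inl M.q0) :: rest) ∧
    ∀ s ∈ rest, ∀ q : M.Q, s ≠ some (Sum.inl q)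

/-- A run matches a partial run if they have the same length and corresponding
configurations match. -/
def MatchesRun (cs : List (List M.Sym)) (ps : List (List (Option M.Sym))) : Prop :=
  List.Forall₂ M.MatchesC cs ps

/-- The run fitting problem for `M` (as a set of partial runs): decide whether a given
partial run of `M` is matched by some accepting run of `M`. -/
def RFit (ps : List (List (Option M.Sym))) : Prop :=
  M.IsPRun ps ∧ ∃ cs, M.IsRun cs ∧ M.Accepting cs ∧ M.MatchesRun cs ps

/-- Encoding of a partial run as a string, using a fresh separator symbol. -/
def encPR (ps : List (List (Option M.Sym))) : List (Option M.Sym ⊕ Unit) :=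
  List.intercalate [Sum.inr ()] (ps.map (List.map Sum.inl))

/-- The run fitting problem for `M` as a formal language. -/
def RFLang : Set (List (Option M.Sym ⊕ Unit)) :=
  { w | ∃ ps, M.RFit ps ∧ w = M.encPR ps }

/-- The initial configuration on input `x` (via the injection `ι` of the input alphabet into
the tape alphabet), padded with `space` blanks. -/
def initConfig {A' : Type} (ι : A' → M.A) (x : List A') (space : ℕ) : List M.Sym :=
  Sum.inl M.q0 :: (x.map fun a => Sum.inr (ι a)) ++ List.replicate space (Sum.inr M.blank)

/-- `M` accepts `x` within `t` steps (and `t` extra tape cells). -/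
def AcceptsIn {A' : Type} (ι : A' → M.A) (x : List A') (t : ℕ) : Prop :=
  ∃ cs, M.IsRun cs ∧ cs.head? = some (M.initConfig ι x t) ∧ cs.length ≤ t + 1 ∧
    M.Accepting cs

end NTM

/-- A Turing machine is deterministic if each state/symbol pair admits at most one
transition. -/
def NTM.Deterministic (M : NTM) : Prop := ∀ q a, (M.δ q a).Subsingleton

/-- A language is in PTime if it is accepted by a deterministic Turing machine in
polynomial time. -/
def InP {A' : Type} (L : Set (List A')) : Prop :=
  ∃ M : NTM, M.Deterministic ∧ ∃ ι : A' → M.A, Function.Injective ι ∧ ∃ p : Polynomial ℕ,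
    ∀ x, x ∈ L ↔ M.AcceptsIn ι x (p.eval x.length)

/-- The relation symbols of the wheel ontology: unary `A, L, R, C`, binary `aux, gen`,
ternary `W`. -/
inductive Rel14 : Type
  | A
  | L
  | R
  | C
  | aux
  | gen
  | W

/-- The signature of the wheel ontology. -/
def σ14 : Sig :=
  ⟨Rel14, fun r => match r with
    | .A => 1 | .L => 1 | .R => 1 | .C => 1 | .aux => 2 | .gen => 2 | .W => 3⟩

/-- The guarded wheel relation
`W'(x,y,z) := W(x,y,z) ∧ ∀aux.A(y) ∧ ∀aux.A(z)`. -/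
def W' {Wc : Type} (B : Interp σ14 Wc) (x y z : Wc) : Prop :=
  (⟨Rel14.W, ![x, y, z]⟩ : Atm σ14 Wc) ∈ B ∧
  (∀ w, (⟨Rel14.aux, ![y, w]⟩ : Atm σ14 Wc) ∈ B → (⟨Rel14.A, ![w]⟩ : Atm σ14 Wc) ∈ B) ∧
  (∀ w, (⟨Rel14.aux, ![z, w]⟩ : Atm σ14 Wc) ∈ B → (⟨Rel14.A, ![w]⟩ : Atm σ14 Wc) ∈ B)

/-- The uGF(2) wheel ontology `O` (using three variables), given semantically.  It contains
`∀x ∃y (aux(x,y) ∧ A(y))`, `∀x ∃y (gen(x,y) ∧ L(y))`, `∀x ∃y (gen(x,y) ∧ R(y))`,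
`∀x (C(x) → (∃gen.¬L(x) ∨ ∃gen.¬R(x)))`, `∀x (C(x) → ∃y₁y₂ W'(x,y₁,y₂))`,
`∀xyz (W'(x,y,z) → (∃gen.¬L(x) → ∃z' W'(x,z,z')))`, and
`∀xyz (W'(x,y,z) → (∃gen.¬R(x) → ∃y' W'(x,y',y)))`. -/
def O14 : Ont σ14 := fun Wc B =>
  (∀ x ∈ B.dom, ∃ y, (⟨Rel14.aux, ![x, y]⟩ : Atm σ14 Wc) ∈ B ∧
    (⟨Rel14.A, ![y]⟩ : Atm σ14 Wc) ∈ B) ∧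
  (∀ x ∈ B.dom, ∃ y, (⟨Rel14.gen, ![x, y]⟩ : Atm σ14 Wc) ∈ B ∧
    (⟨Rel14.L, ![y]⟩ : Atm σ14 Wc) ∈ B) ∧
  (∀ x ∈ B.dom, ∃ y, (⟨Rel14.gen, ![x, y]⟩ : Atm σ14 Wc) ∈ B ∧
    (⟨Rel14.R, ![y]⟩ : Atm σ14 Wc) ∈ B) ∧
  (∀ x ∈ B.dom, (⟨Rel14.C, ![x]⟩ : Atm σ14 Wc) ∈ B →
    (∃ y, (⟨Rel14.gen, ![x, y]⟩ : Atm σ14 Wc) ∈ B ∧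
      (⟨Rel14.L, ![y]⟩ : Atm σ14 Wc) ∉ B) ∨
    (∃ y, (⟨Rel14.gen, ![x, y]⟩ : Atm σ14 Wc) ∈ B ∧
      (⟨Rel14.R, ![y]⟩ : Atm σ14 Wc) ∉ B)) ∧
  (∀ x ∈ B.dom, (⟨Rel14.C, ![x]⟩ : Atm σ14 Wc) ∈ B → ∃ y z, W' B x y z) ∧
  (∀ x y z, W' B x y z →
    (∃ w, (⟨Rel14.gen, ![x, w]⟩ : Atm σ14 Wc) ∈ B ∧
      (⟨Rel14.L, ![w]⟩ : Atm σ14 Wc) ∉ B) → ∃ z', W' B x z z') ∧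
  (∀ x y z, W' B x y z →
    (∃ w, (⟨Rel14.gen, ![x, w]⟩ : Atm σ14 Wc) ∈ B ∧
      (⟨Rel14.R, ![w]⟩ : Atm σ14 Wc) ∉ B) → ∃ y', W' B x y' y)

/-- The instance `D = {C(a)}`. -/
def D14 : Interp σ14 Unit := {⟨Rel14.C, ![()]⟩}

/-- `(W, ι, B)` is a CQ-materialization of `O` and `D`. -/
def IsCQMat14 {V Wc : Type} (D : Interp σ14 V) (ι : V → Wc) (B : Interp σ14 Wc) : Prop :=
  IsMod O14 D ι B ∧ ∀ (k : ℕ) (q : CQ σ14 k) (a : Fin k → V), (∀ i, a i ∈ D.dom) →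
    (CQAns B q (ι ∘ a) ↔ CertainCQ O14 D q a)

/-- Syntactic facts over the data constants `ℕ`, used as inputs of the query evaluation
problem. -/
inductive F14 : Type
  | fA (m : ℕ)
  | fL (m : ℕ)
  | fR (m : ℕ)
  | fC (m : ℕ)
  | faux (m k : ℕ)
  | fgen (m k : ℕ)
  | fW (m k l : ℕ)

/-- The atom denoted by a syntactic fact. -/
def F14.toAtm : F14 → Atm σ14 ℕ
  | .fA m => ⟨Rel14.A, ![m]⟩
  | .fL m => ⟨Rel14.L, ![m]⟩
  | .fR m => ⟨Rel14.R, ![m]⟩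
  | .fC m => ⟨Rel14.C, ![m]⟩
  | .faux m k => ⟨Rel14.aux, ![m, k]⟩
  | .fgen m k => ⟨Rel14.gen, ![m, k]⟩
  | .fW m k l => ⟨Rel14.W, ![m, k, l]⟩

/-- The instance denoted by a list of syntactic facts. -/
def toInterp14 (Dl : List F14) : Interp σ14 ℕ := { g | ∃ f ∈ Dl, g = f.toAtm }

/-- Binary encoding of a natural number. -/
def encNat (m : ℕ) : List (Fin 8 ⊕ Bool) := (Nat.bits m).map Sum.inr

/-- Encoding of a syntactic fact as a string. -/
def encF : F14 → List (Fin 8 ⊕ Bool)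
  | .fA m => Sum.inl 0 :: encNat m
  | .fL m => Sum.inl 1 :: encNat m
  | .fR m => Sum.inl 2 :: encNat m
  | .fC m => Sum.inl 3 :: encNat m
  | .faux m k => Sum.inl 4 :: (encNat m ++ Sum.inl 7 :: encNat k)
  | .fgen m k => Sum.inl 5 :: (encNat m ++ Sum.inl 7 :: encNat k)
  | .fW m k l =>
      Sum.inl 6 :: (encNat m ++ Sum.inl 7 :: encNat k ++ Sum.inl 7 :: encNat l)

/-- Encoding of an input (an instance together with a candidate answer tuple) as a
string. -/
def encInput (Dl : List F14) (t : List ℕ) : List (Fin 8 ⊕ Bool) :=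
  (Dl.map fun f => encF f ++ [Sum.inl 7]).flatten ++ [Sum.inl 7] ++
    (t.map fun m => encNat m ++ [Sum.inl 7]).flatten

/-- The query evaluation problem for the OMQ `(O14, q)` as a formal language: encodings of
pairs of an instance `D` and a tuple `a` over `dom(D)` such that `a` is a certain answer
to `q` on `D` given `O14`. -/
def EvalLang14 {k : ℕ} (q : CQ σ14 k) : Set (List (Fin 8 ⊕ Bool)) :=
  { w | ∃ (Dl : List F14) (t : Fin k → ℕ),
      w = encInput Dl ((List.finRange k).map t) ∧
      (∀ i, t i ∈ (toInterp14 Dl).dom) ∧ CertainCQ O14 (toInterp14 Dl) q t }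

namespace Wheel

/-! ### Interpretations over `σ14` given by their seven relations -/

/-- The interpretation with the given extensions of the relation symbols. -/
def mk {V : Type} (pA pL pR pC : V → Prop) (paux pgen : V → V → Prop)
    (pW : V → V → V → Prop) : Interp σ14 V := fun g =>
  match g with
  | ⟨.A, v⟩ => pA (v (0 : Fin 1))
  | ⟨.L, v⟩ => pL (v (0 : Fin 1))
  | ⟨.R, v⟩ => pR (v (0 : Fin 1))
  | ⟨.C, v⟩ => pC (v (0 : Fin 1))
  | ⟨.aux, v⟩ => paux (v (0 : Fin 2)) (v (1 : Fin 2))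
  | ⟨.gen, v⟩ => pgen (v (0 : Fin 2)) (v (1 : Fin 2))
  | ⟨.W, v⟩ => pW (v (0 : Fin 3)) (v (1 : Fin 3)) (v (2 : Fin 3))

section mk
variable {V : Type} {pA pL pR pC : V → Prop} {paux pgen : V → V → Prop} {pW : V → V → V → Prop}

@[simp] lemma mk_A (x : V) : (⟨Rel14.A, ![x]⟩ : Atm σ14 V) ∈ mk pA pL pR pC paux pgen pW ↔ pA x :=
  Iff.rfl
@[simp] lemma mk_L (x : V) : (⟨Rel14.L, ![x]⟩ : Atm σ14 V) ∈ mk pA pL pR pC paux pgen pW ↔ pL x :=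
  Iff.rfl
@[simp] lemma mk_R (x : V) : (⟨Rel14.R, ![x]⟩ : Atm σ14 V) ∈ mk pA pL pR pC paux pgen pW ↔ pR x :=
  Iff.rfl
@[simp] lemma mk_C (x : V) : (⟨Rel14.C, ![x]⟩ : Atm σ14 V) ∈ mk pA pL pR pC paux pgen pW ↔ pC x :=
  Iff.rfl
@[simp] lemma mk_aux (x y : V) :
    (⟨Rel14.aux, ![x, y]⟩ : Atm σ14 V) ∈ mk pA pL pR pC paux pgen pW ↔ paux x y := Iff.rfl
@[simp] lemma mk_gen (x y : V) :
    (⟨Rel14.gen, ![x, y]⟩ : Atm σ14 V) ∈ mk pA pL pR pC paux pgen pW ↔ pgen x y := Iff.rfl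
@[simp] lemma mk_W (x y z : V) :
    (⟨Rel14.W, ![x, y, z]⟩ : Atm σ14 V) ∈ mk pA pL pR pC paux pgen pW ↔ pW x y z := Iff.rfl

end mk

lemma comp_vec1 {V W : Type} (h : V → W) (v : Fin 1 → V) : h ∘ v = ![h (v 0)] := by
  funext i; fin_cases i; rfl

lemma comp_vec2 {V W : Type} (h : V → W) (v : Fin 2 → V) : h ∘ v = ![h (v 0), h (v 1)] := by
  funext i; fin_cases i <;> rfl

lemma comp_vec3 {V W : Type} (h : V → W) (v : Fin 3 → V) :
    h ∘ v = ![h (v 0), h (v 1), h (v 2)] := by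
  funext i; fin_cases i <;> rfl

/-- Case analysis on an atom over `σ14`. -/
lemma atm_cases {V : Type} {P : Atm σ14 V → Prop}
    (hA : ∀ x, P ⟨Rel14.A, ![x]⟩) (hL : ∀ x, P ⟨Rel14.L, ![x]⟩)
    (hR : ∀ x, P ⟨Rel14.R, ![x]⟩) (hC : ∀ x, P ⟨Rel14.C, ![x]⟩)
    (haux : ∀ x y, P ⟨Rel14.aux, ![x, y]⟩) (hgen : ∀ x y, P ⟨Rel14.gen, ![x, y]⟩)
    (hW : ∀ x y z, P ⟨Rel14.W, ![x, y, z]⟩) (g : Atm σ14 V) : P g := by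
  obtain ⟨r, v⟩ := g
  cases r
  · exact (show ∀ v : Fin 1 → V, P ⟨Rel14.A, v⟩ from fun v => by
      rw [show v = ![v 0] from comp_vec1 id v]; exact hA _) v
  · exact (show ∀ v : Fin 1 → V, P ⟨Rel14.L, v⟩ from fun v => by
      rw [show v = ![v 0] from comp_vec1 id v]; exact hL _) v
  · exact (show ∀ v : Fin 1 → V, P ⟨Rel14.R, v⟩ from fun v => by
      rw [show v = ![v 0] from comp_vec1 id v]; exact hR _) v
  · exact (show ∀ v : Fin 1 → V, P ⟨Rel14.C, v⟩ from fun v => by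
      rw [show v = ![v 0] from comp_vec1 id v]; exact hC _) v
  · exact (show ∀ v : Fin 2 → V, P ⟨Rel14.aux, v⟩ from fun v => by
      rw [show v = ![v 0, v 1] from comp_vec2 id v]; exact haux _ _) v
  · exact (show ∀ v : Fin 2 → V, P ⟨Rel14.gen, v⟩ from fun v => by
      rw [show v = ![v 0, v 1] from comp_vec2 id v]; exact hgen _ _) v
  · exact (show ∀ v : Fin 3 → V, P ⟨Rel14.W, v⟩ from fun v => by
      rw [show v = ![v 0, v 1, v 2] from comp_vec3 id v]; exact hW _ _ _) v

/-- The image of an atom under a map. -/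
def mapAtm {V W : Type} (h : V → W) (g : Atm σ14 V) : Atm σ14 W := ⟨g.1, h ∘ g.2⟩

section mapAtm
variable {V W : Type} (h : V → W)

@[simp] lemma mapAtm_A (x : V) : mapAtm h ⟨Rel14.A, ![x]⟩ = ⟨Rel14.A, ![h x]⟩ :=
  congrArg (Sigma.mk Rel14.A) (comp_vec1 h ![x])
@[simp] lemma mapAtm_L (x : V) : mapAtm h ⟨Rel14.L, ![x]⟩ = ⟨Rel14.L, ![h x]⟩ :=
  congrArg (Sigma.mk Rel14.L) (comp_vec1 h ![x])
@[simp] lemma mapAtm_R (x : V) : mapAtm h ⟨Rel14.R, ![x]⟩ = ⟨Rel14.R, ![h x]⟩ :=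
  congrArg (Sigma.mk Rel14.R) (comp_vec1 h ![x])
@[simp] lemma mapAtm_C (x : V) : mapAtm h ⟨Rel14.C, ![x]⟩ = ⟨Rel14.C, ![h x]⟩ :=
  congrArg (Sigma.mk Rel14.C) (comp_vec1 h ![x])
@[simp] lemma mapAtm_aux (x y : V) :
    mapAtm h ⟨Rel14.aux, ![x, y]⟩ = ⟨Rel14.aux, ![h x, h y]⟩ :=
  congrArg (Sigma.mk Rel14.aux) (comp_vec2 h ![x, y])
@[simp] lemma mapAtm_gen (x y : V) :
    mapAtm h ⟨Rel14.gen, ![x, y]⟩ = ⟨Rel14.gen, ![h x, h y]⟩ :=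
  congrArg (Sigma.mk Rel14.gen) (comp_vec2 h ![x, y])
@[simp] lemma mapAtm_W (x y z : V) :
    mapAtm h ⟨Rel14.W, ![x, y, z]⟩ = ⟨Rel14.W, ![h x, h y, h z]⟩ :=
  congrArg (Sigma.mk Rel14.W) (comp_vec3 h ![x, y, z])

end mapAtm

lemma isHom_iff {V W : Type} {A : Interp σ14 V} {B : Interp σ14 W} {h : V → W} :
    IsHom A B h ↔ ∀ g ∈ A, mapAtm h g ∈ B := Iff.rfl

section dom
variable {V : Type} {B : Interp σ14 V} {x y z : V}

lemma dom_A (h : (⟨Rel14.A, ![x]⟩ : Atm σ14 V) ∈ B) : x ∈ B.dom := ⟨_, h, (0 : Fin 1), rfl⟩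
lemma dom_L (h : (⟨Rel14.L, ![x]⟩ : Atm σ14 V) ∈ B) : x ∈ B.dom := ⟨_, h, (0 : Fin 1), rfl⟩
lemma dom_R (h : (⟨Rel14.R, ![x]⟩ : Atm σ14 V) ∈ B) : x ∈ B.dom := ⟨_, h, (0 : Fin 1), rfl⟩
lemma dom_C (h : (⟨Rel14.C, ![x]⟩ : Atm σ14 V) ∈ B) : x ∈ B.dom := ⟨_, h, (0 : Fin 1), rfl⟩
lemma dom_aux_left (h : (⟨Rel14.aux, ![x, y]⟩ : Atm σ14 V) ∈ B) : x ∈ B.dom :=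
  ⟨_, h, (0 : Fin 2), rfl⟩
lemma dom_aux_right (h : (⟨Rel14.aux, ![x, y]⟩ : Atm σ14 V) ∈ B) : y ∈ B.dom :=
  ⟨_, h, (1 : Fin 2), rfl⟩
lemma dom_gen_left (h : (⟨Rel14.gen, ![x, y]⟩ : Atm σ14 V) ∈ B) : x ∈ B.dom :=
  ⟨_, h, (0 : Fin 2), rfl⟩
lemma dom_gen_right (h : (⟨Rel14.gen, ![x, y]⟩ : Atm σ14 V) ∈ B) : y ∈ B.dom :=
  ⟨_, h, (1 : Fin 2), rfl⟩
lemma dom_W_left (h : (⟨Rel14.W, ![x, y, z]⟩ : Atm σ14 V) ∈ B) : x ∈ B.dom :=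
  ⟨_, h, (0 : Fin 3), rfl⟩
lemma dom_W_mid (h : (⟨Rel14.W, ![x, y, z]⟩ : Atm σ14 V) ∈ B) : y ∈ B.dom :=
  ⟨_, h, (1 : Fin 3), rfl⟩
lemma dom_W_right (h : (⟨Rel14.W, ![x, y, z]⟩ : Atm σ14 V) ∈ B) : z ∈ B.dom :=
  ⟨_, h, (2 : Fin 3), rfl⟩

/-- Every element of the domain of an interpretation satisfies `P` if the arguments of all
its facts do. -/
lemma dom_induction {P : V → Prop}
    (hA : ∀ x, (⟨Rel14.A, ![x]⟩ : Atm σ14 V) ∈ B → P x)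
    (hL : ∀ x, (⟨Rel14.L, ![x]⟩ : Atm σ14 V) ∈ B → P x)
    (hR : ∀ x, (⟨Rel14.R, ![x]⟩ : Atm σ14 V) ∈ B → P x)
    (hC : ∀ x, (⟨Rel14.C, ![x]⟩ : Atm σ14 V) ∈ B → P x)
    (haux : ∀ x y, (⟨Rel14.aux, ![x, y]⟩ : Atm σ14 V) ∈ B → P x ∧ P y)
    (hgen : ∀ x y, (⟨Rel14.gen, ![x, y]⟩ : Atm σ14 V) ∈ B → P x ∧ P y)
    (hW : ∀ x y z, (⟨Rel14.W, ![x, y, z]⟩ : Atm σ14 V) ∈ B → P x ∧ P y ∧ P z)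
    (x : V) (hx : x ∈ B.dom) : P x := by
  obtain ⟨g, hg, i, rfl⟩ := hx
  revert hg i
  refine atm_cases (P := fun g => g ∈ B → ∀ i, P (g.2 i)) ?_ ?_ ?_ ?_ ?_ ?_ ?_ g
  · rintro x h (i : Fin 1); fin_cases i; exact hA x h
  · rintro x h (i : Fin 1); fin_cases i; exact hL x h
  · rintro x h (i : Fin 1); fin_cases i; exact hR x h
  · rintro x h (i : Fin 1); fin_cases i; exact hC x h
  · rintro x y h (i : Fin 2); fin_cases i; exacts [(haux x y h).1, (haux x y h).2]
  · rintro x y h (i : Fin 2); fin_cases i; exacts [(hgen x y h).1, (hgen x y h).2]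
  · rintro x y z h (i : Fin 3)
    fin_cases i; exacts [(hW x y z h).1, (hW x y z h).2.1, (hW x y z h).2.2]

end dom

/-! ### There is no hom-universal model -/

/-- The elements of the models of `D14` in which the wheel turns in one direction only:
the centre, an element carrying all unary markers, the element carrying a single marker, and
the rim. -/
inductive OneWay : Type
  | center
  | full
  | side
  | rim (n : ℕ)

/-- The model of `D14` in which the wheel turns right (`d = true`) or left (`d = false`). -/
def oneWay (d : Bool) : Interp σ14 OneWay :=
  mk (fun x => x = .full) (fun x => x = .full ∨ (x = .side ∧ d = false))
    (fun x => x = .full ∨ (x = .side ∧ d = true)) (fun x => x = .center)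
    (fun _ y => y = .full) (fun x y => y = .full ∨ (x = .center ∧ y = .side))
    (fun x y z => x = .center ∧ ∃ n,
      if d then y = .rim n ∧ z = .rim (n + 1) else y = .rim (n + 1) ∧ z = .rim n)

lemma oneWay_W' (d : Bool) (x y z : OneWay) : W' (oneWay d) x y z ↔
    x = .center ∧ ∃ n, if d then y = .rim n ∧ z = .rim (n + 1)
      else y = .rim (n + 1) ∧ z = .rim n := by
  simp [W', oneWay]

lemma oneWay_isMod (d : Bool) :
    IsMod O14 D14 (fun _ => OneWay.center) (oneWay d) := by
  refine ⟨fun _ _ _ => rfl, ?_, ?_⟩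
  · rw [isHom_iff]
    rintro g rfl
    simp [oneWay]
  · refine ⟨?_, ?_, ?_, ?_, ?_, ?_, ?_⟩
    · intro x _; exact ⟨.full, by simp [oneWay]⟩
    · intro x _; exact ⟨.full, by simp [oneWay]⟩
    · intro x _; exact ⟨.full, by simp [oneWay]⟩
    · rintro x - hx
      obtain rfl : x = .center := hx
      cases d
      · exact Or.inr ⟨.side, by simp [oneWay]⟩
      · exact Or.inl ⟨.side, by simp [oneWay]⟩
    · rintro x - hx
      obtain rfl : x = .center := hx
      simp only [oneWay_W']
      cases d
      · exact ⟨.rim 1, .rim 0, trivial, 0, by simp⟩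
      · exact ⟨.rim 0, .rim 1, trivial, 0, by simp⟩
    · intro x y z h
      rw [oneWay_W'] at h
      obtain ⟨rfl, n, h⟩ := h
      rintro ⟨w, hw, hw'⟩
      simp only [oneWay_W']
      cases d
      · simp [oneWay] at hw hw'
        tauto
      · simp only [if_true] at h ⊢
        exact ⟨.rim (n + 2), trivial, n + 1, h.2, rfl⟩
    · intro x y z h
      rw [oneWay_W'] at h
      obtain ⟨rfl, n, h⟩ := h
      rintro ⟨w, hw, hw'⟩
      simp only [oneWay_W']
      cases d
      · simp only [Bool.false_eq_true, if_false] at h ⊢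
        exact ⟨.rim (n + 2), trivial, n + 1, rfl, h.1⟩
      · simp [oneWay] at hw hw'
        tauto

lemma no_homUniversal :
    ¬ (∃ (Wc : Type) (ι : Unit → Wc) (B : Interp σ14 Wc), IsMod O14 D14 ι B ∧
        ∀ (Wc' : Type) (ι' : Unit → Wc') (B' : Interp σ14 Wc'), IsMod O14 D14 ι' B' →
          ∃ g : Wc → Wc', IsHom B B' g ∧ g ∘ ι = ι') := by
  rintro ⟨Wc, ι, B, ⟨-, hD, hO⟩, hu⟩
  have hC : (⟨Rel14.C, ![ι ()]⟩ : Atm σ14 Wc) ∈ B := by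
    have := isHom_iff.1 hD ⟨Rel14.C, ![()]⟩ rfl
    simpa using this
  obtain ⟨-, -, -, hLR, hW, hright, hleft⟩ := hO
  obtain ⟨y, z, hyz⟩ := hW _ (dom_C hC) hC
  rcases hLR _ (dom_C hC) hC with hL | hR
  · obtain ⟨g, hg, hgι⟩ := hu _ _ _ (oneWay_isMod false)
    have key : ∀ n y z, W' B (ι ()) y z → g z ≠ .rim n := by
      intro n
      induction n with
      | zero =>
        intro y z h hz
        obtain ⟨z', h'⟩ := hright _ _ _ h hL
        have := isHom_iff.1 hg _ h'.1
        simp [oneWay, hz] at this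
      | succ n ih =>
        intro y z h hz
        obtain ⟨z', h'⟩ := hright _ _ _ h hL
        have := isHom_iff.1 hg _ h'.1
        simp [oneWay, hz] at this
        exact ih _ _ h' this.2
    have := isHom_iff.1 hg _ hyz.1
    simp [oneWay] at this
    obtain ⟨-, n, -, hn⟩ := this
    exact key _ _ _ hyz hn
  · obtain ⟨g, hg, hgι⟩ := hu _ _ _ (oneWay_isMod true)
    have key : ∀ n y z, W' B (ι ()) y z → g y ≠ .rim n := by
      intro n
      induction n with
      | zero =>
        intro y z h hz
        obtain ⟨z', h'⟩ := hleft _ _ _ h hR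
        have := isHom_iff.1 hg _ h'.1
        simp [oneWay, hz] at this
      | succ n ih =>
        intro y z h hz
        obtain ⟨z', h'⟩ := hleft _ _ _ h hR
        have := isHom_iff.1 hg _ h'.1
        simp [oneWay, hz] at this
        exact ih _ _ h' this.2
    have := isHom_iff.1 hg _ hyz.1
    simp [oneWay] at this
    obtain ⟨-, n, hn, -⟩ := this
    exact key _ _ _ hyz hn

/-! ### The materialization -/

/-- The starting points of the trees attached to a constant: the constant itself, an
`aux`-successor outside `A`, and the rim of a wheel that turns in both directions. -/
inductive Start : Type
  | root
  | bad
  | rim (i : ℤ)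

/-- The elements of the materialization: below every starting point there is a tree whose
edges `0`, `1`, `2` lead to the `aux`-successor in `A` and to the `gen`-successors in `L`
and in `R`. -/
abbrev Elt (V : Type) : Type := V × Start × List (Fin 3)

/-- A constant as an element of the materialization. -/
def root {V : Type} (v : V) : Elt V := (v, .root, [])

section mat
variable {V : Type} (D : Interp σ14 V)

/-- The starting points present at the constant `v`. -/
def Act (v : V) : Start → Prop
  | .rim _ => v ∈ D.dom ∧ (⟨Rel14.C, ![v]⟩ : Atm σ14 V) ∈ D
  | _ => v ∈ D.dom

inductive MatA : Elt V → Prop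
  | base {v} (h : (⟨Rel14.A, ![v]⟩ : Atm σ14 V) ∈ D) : MatA (root v)
  | tree {v s l} (h : Act D v s) : MatA (v, s, 0 :: l)

inductive MatL : Elt V → Prop
  | base {v} (h : (⟨Rel14.L, ![v]⟩ : Atm σ14 V) ∈ D) : MatL (root v)
  | tree {v s l} (h : Act D v s) : MatL (v, s, 1 :: l)

inductive MatR : Elt V → Prop
  | base {v} (h : (⟨Rel14.R, ![v]⟩ : Atm σ14 V) ∈ D) : MatR (root v)
  | tree {v s l} (h : Act D v s) : MatR (v, s, 2 :: l)

inductive MatC : Elt V → Prop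
  | base {v} (h : (⟨Rel14.C, ![v]⟩ : Atm σ14 V) ∈ D) : MatC (root v)

inductive MatAux : Elt V → Elt V → Prop
  | base {v w} (h : (⟨Rel14.aux, ![v, w]⟩ : Atm σ14 V) ∈ D) : MatAux (root v) (root w)
  | tree {v s l} (h : Act D v s) : MatAux (v, s, l) (v, s, 0 :: l)
  | bad {v} (h : v ∈ D.dom) : MatAux (root v) (v, .bad, [])

inductive MatGen : Elt V → Elt V → Prop
  | base {v w} (h : (⟨Rel14.gen, ![v, w]⟩ : Atm σ14 V) ∈ D) : MatGen (root v) (root w)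
  | left {v s l} (h : Act D v s) : MatGen (v, s, l) (v, s, 1 :: l)
  | right {v s l} (h : Act D v s) : MatGen (v, s, l) (v, s, 2 :: l)

inductive MatW : Elt V → Elt V → Elt V → Prop
  | base {v w u} (h : (⟨Rel14.W, ![v, w, u]⟩ : Atm σ14 V) ∈ D) :
      MatW (root v) (root w) (root u)
  | wheel {v} (i : ℤ) (h : v ∈ D.dom) (hC : (⟨Rel14.C, ![v]⟩ : Atm σ14 V) ∈ D) :
      MatW (root v) (v, .rim i, []) (v, .rim (i + 1), [])

/-- The materialization of an instance. -/
def mat : Interp σ14 (Elt V) :=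
  mk (MatA D) (MatL D) (MatR D) (MatC D) (MatAux D) (MatGen D) (MatW D)

variable {D}

lemma mat_dom (e : Elt V) (he : e ∈ (mat D).dom) : Act D e.1 e.2.1 := by
  refine dom_induction (P := fun e : Elt V => Act D e.1 e.2.1) ?_ ?_ ?_ ?_ ?_ ?_ ?_ e he
  · rintro _ (h | h)
    exacts [dom_A h, h]
  · rintro _ (h | h)
    exacts [dom_L h, h]
  · rintro _ (h | h)
    exacts [dom_R h, h]
  · rintro _ ⟨h⟩
    exact dom_C h
  · rintro _ _ (h | h | h)
    exacts [⟨dom_aux_left h, dom_aux_right h⟩, ⟨h, h⟩, ⟨h, h⟩]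
  · rintro _ _ (h | h | h)
    exacts [⟨dom_gen_left h, dom_gen_right h⟩, ⟨h, h⟩, ⟨h, h⟩]
  · rintro _ _ _ (h | ⟨i, h, hC⟩)
    exacts [⟨dom_W_left h, dom_W_mid h, dom_W_right h⟩, ⟨h, ⟨h, hC⟩, ⟨h, hC⟩⟩]

lemma rim_aux {v : V} {i : ℤ} {w : Elt V} (h : MatAux D (v, .rim i, []) w) : MatA D w := by
  rcases h with h | h | h
  exact .tree h

lemma not_matA_bad {v : V} : ¬ MatA D (v, .bad, []) := by
  rintro (h | h)

lemma wheel_W' {v : V} (h : v ∈ D.dom) (hC : (⟨Rel14.C, ![v]⟩ : Atm σ14 V) ∈ D) (i : ℤ) :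
    W' (mat D) (root v) (v, .rim i, []) (v, .rim (i + 1), []) :=
  ⟨MatW.wheel i h hC, fun _ hw => rim_aux hw, fun _ hw => rim_aux hw⟩

lemma of_W' {x y z : Elt V} (h : W' (mat D) x y z) :
    ∃ v i, v ∈ D.dom ∧ (⟨Rel14.C, ![v]⟩ : Atm σ14 V) ∈ D ∧ x = root v ∧
      y = (v, .rim i, []) ∧ z = (v, .rim (i + 1), []) := by
  obtain ⟨hW, hy, -⟩ := h
  rcases (hW : MatW D x y z) with h | ⟨i, h, hC⟩
  · exact absurd (hy _ (MatAux.bad (dom_W_mid h))) not_matA_bad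
  · exact ⟨_, i, h, hC, rfl, rfl, rfl⟩

lemma mat_model : O14 (Elt V) (mat D) := by
  refine ⟨?_, ?_, ?_, ?_, ?_, ?_, ?_⟩
  · intro x hx
    exact ⟨(x.1, x.2.1, 0 :: x.2.2), MatAux.tree (mat_dom x hx), MatA.tree (mat_dom x hx)⟩
  · intro x hx
    exact ⟨(x.1, x.2.1, 1 :: x.2.2), MatGen.left (mat_dom x hx), MatL.tree (mat_dom x hx)⟩
  · intro x hx
    exact ⟨(x.1, x.2.1, 2 :: x.2.2), MatGen.right (mat_dom x hx), MatR.tree (mat_dom x hx)⟩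
  · intro x hx _
    refine Or.inl ⟨(x.1, x.2.1, 2 :: x.2.2), MatGen.right (mat_dom x hx), ?_⟩
    intro h
    obtain ⟨v, s, l⟩ := x
    rcases (h : MatL D (v, s, 2 :: l)) with h | h
  · intro x hx h
    obtain ⟨h⟩ := (h : MatC D x)
    exact ⟨_, _, wheel_W' (dom_C h) h 0⟩
  · intro x y z h _
    obtain ⟨v, i, hv, hC, rfl, rfl, rfl⟩ := of_W' h
    exact ⟨_, wheel_W' hv hC (i + 1)⟩
  · intro x y z h _
    obtain ⟨v, i, hv, hC, rfl, rfl, rfl⟩ := of_W' h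
    refine ⟨(v, .rim (i - 1), []), ?_⟩
    have := wheel_W' hv hC (i - 1)
    rwa [sub_add_cancel] at this

lemma root_injective : Function.Injective (root : V → Elt V) := fun _ _ h => congrArg Prod.fst h

lemma mat_isMod : IsMod O14 D root (mat D) := by
  refine ⟨root_injective, isHom_iff.2 ?_, mat_model⟩
  intro g
  refine atm_cases (P := fun g => g ∈ D → mapAtm root g ∈ mat D) ?_ ?_ ?_ ?_ ?_ ?_ ?_ g <;>
    intros <;> simp only [mapAtm_A, mapAtm_L, mapAtm_R, mapAtm_C, mapAtm_aux, mapAtm_gen, mapAtm_W]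
  exacts [MatA.base ‹_›, MatL.base ‹_›, MatR.base ‹_›, MatC.base ‹_›, MatAux.base ‹_›,
    MatGen.base ‹_›, MatW.base ‹_›]

end mat

/-! ### Finite parts of the materialization map into every model -/

/-- In every model, a constant in `C` is the centre of arbitrarily long partial wheels. -/
lemma exists_wheel {W : Type} {A : Interp σ14 W} (hO : O14 W A) {x : W}
    (hx : (⟨Rel14.C, ![x]⟩ : Atm σ14 W) ∈ A) (N : ℤ) :
    ∃ p : ℤ → W, (∀ i, p i ∈ A.dom) ∧
      ∀ i, -N ≤ i → i < N → (⟨Rel14.W, ![x, p i, p (i + 1)]⟩ : Atm σ14 W) ∈ A := by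
  obtain ⟨-, -, -, hLR, hW, hright, hleft⟩ := hO
  obtain ⟨y, z, hyz⟩ := hW x (dom_C hx) hx
  rcases hLR x (dom_C hx) hx with hL | hR
  · choose! f hf using fun y z (h : W' A x y z) => hright x y z h hL
    let s : ℕ → {p : W × W // W' A x p.1 p.2} := fun n =>
      Nat.rec ⟨(y, z), hyz⟩ (fun _ p => ⟨(p.1.2, f p.1.1 p.1.2), hf _ _ p.2⟩) n
    refine ⟨fun i => (s (i + N).toNat).1.1, fun i => dom_W_mid (s _).2.1, ?_⟩
    intro i h1 h2
    have h := (s (i + N).toNat).2.1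
    have e : (i + 1 + N).toNat = (i + N).toNat + 1 := by omega
    simp only [e]
    exact h
  · choose! f hf using fun y z (h : W' A x y z) => hleft x y z h hR
    let s : ℕ → {p : W × W // W' A x p.1 p.2} := fun n =>
      Nat.rec ⟨(y, z), hyz⟩ (fun _ p => ⟨(f p.1.1 p.1.2, p.1.1), hf _ _ p.2⟩) n
    refine ⟨fun i => (s (N - i).toNat).1.2, fun i => dom_W_right (s _).2.1, ?_⟩
    intro i h1 h2
    have h := (s (N - (i + 1)).toNat).2.1
    have e : (N - i).toNat = (N - (i + 1)).toNat + 1 := by omega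
    simp only [e]
    exact h

/-- The numbers of the rim elements occurring in an element of the materialization. -/
def rimBound {V : Type} : Elt V → ℕ
  | (_, .rim i, _) => i.natAbs
  | _ => 0

/-- Every part of the materialization with bounded rim elements maps into every model. -/
lemma exists_partial_hom {V W : Type} {D : Interp σ14 V} {ι : V → W} {A : Interp σ14 W}
    (hA : IsMod O14 D ι A) (N : ℕ) :
    ∃ G : Elt V → W, (∀ v, G (root v) = ι v) ∧
      ∀ g ∈ mat D, (∀ i, rimBound (g.2 i) < N) → mapAtm G g ∈ A := by
  classical
  obtain ⟨-, hD, hO⟩ := hA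
  have hD' := isHom_iff.1 hD
  have hw : ∀ v, (⟨Rel14.C, ![v]⟩ : Atm σ14 V) ∈ D → ∃ p : ℤ → W, (∀ i, p i ∈ A.dom) ∧
      ∀ i, -(N : ℤ) ≤ i → i < N → (⟨Rel14.W, ![ι v, p i, p (i + 1)]⟩ : Atm σ14 W) ∈ A := by
    intro v hv
    have := hD' _ hv
    rw [mapAtm_C] at this
    exact exists_wheel hO this N
  have hw' : ∀ v, ∃ p : ℤ → W, (⟨Rel14.C, ![v]⟩ : Atm σ14 V) ∈ D → (∀ i, p i ∈ A.dom) ∧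
      ∀ i, -(N : ℤ) ≤ i → i < N → (⟨Rel14.W, ![ι v, p i, p (i + 1)]⟩ : Atm σ14 W) ∈ A := by
    intro v
    by_cases hv : (⟨Rel14.C, ![v]⟩ : Atm σ14 V) ∈ D
    · obtain ⟨p, hp⟩ := hw v hv
      exact ⟨p, fun _ => hp⟩
    · exact ⟨fun _ => ι v, fun h => absurd h hv⟩
  choose p hp using hw'
  obtain ⟨h1, h2, h3, -⟩ := hO
  choose! fa hfa hfA using h1
  choose! fl hfl hfL using h2
  choose! fr hfr hfR using h3
  let st : V → Start → W := fun v s => match s with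
    | .root => ι v
    | .bad => fa (ι v)
    | .rim i => p v i
  let f : Fin 3 → W → W := ![fa, fl, fr]
  let G : Elt V → W := fun e => e.2.2.foldr f (st e.1 e.2.1)
  have hι : ∀ v ∈ D.dom, ι v ∈ A.dom := by
    rintro v ⟨g, hg, i, rfl⟩
    exact ⟨_, hD' g hg, i, rfl⟩
  have hf : ∀ c, ∀ x ∈ A.dom, f c x ∈ A.dom := by
    intro c x hx
    fin_cases c
    exacts [dom_A (hfA x hx), dom_L (hfL x hx), dom_R (hfR x hx)]
  have hG : ∀ v s l, Act D v s → G (v, s, l) ∈ A.dom := by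
    intro v s l h
    induction l with
    | nil =>
      cases s with
      | root => exact hι v h
      | bad => exact hf 0 _ (hι v h)
      | rim i => exact (hp v h.2).1 i
    | cons c l ih => exact hf c _ ih
  have hDr : ∀ g ∈ D, mapAtm G (mapAtm root g) ∈ A := fun g hg => hD' g hg
  refine ⟨G, fun v => rfl, ?_⟩
  intro g
  refine atm_cases (P := fun g => g ∈ mat D → (∀ i, rimBound (g.2 i) < N) → mapAtm G g ∈ A)
    ?_ ?_ ?_ ?_ ?_ ?_ ?_ g
  · rintro x (h | @⟨v, s, l, h⟩) -
    · simpa [root] using hDr _ h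
    · rw [mapAtm_A]
      exact hfA (G (v, s, l)) (hG v s l h)
  · rintro x (h | @⟨v, s, l, h⟩) -
    · simpa [root] using hDr _ h
    · rw [mapAtm_L]
      exact hfL (G (v, s, l)) (hG v s l h)
  · rintro x (h | @⟨v, s, l, h⟩) -
    · simpa [root] using hDr _ h
    · rw [mapAtm_R]
      exact hfR (G (v, s, l)) (hG v s l h)
  · rintro x ⟨h⟩ -
    simpa [root] using hDr _ h
  · rintro x y (h | @⟨v, s, l, h⟩ | @⟨v, h⟩) -
    · simpa [root] using hDr _ h
    · rw [mapAtm_aux]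
      exact hfa (G (v, s, l)) (hG v s l h)
    · rw [mapAtm_aux]
      exact hfa (ι v) (hι v h)
  · rintro x y (h | @⟨v, s, l, h⟩ | @⟨v, s, l, h⟩) -
    · simpa [root] using hDr _ h
    · rw [mapAtm_gen]
      exact hfl (G (v, s, l)) (hG v s l h)
    · rw [mapAtm_gen]
      exact hfr (G (v, s, l)) (hG v s l h)
  · rintro x y z (h | ⟨i, h, hC⟩) hN
    · simpa [root] using hDr _ h
    · rw [mapAtm_W]
      have h1 := hN (1 : Fin 3)
      simp [rimBound] at h1
      exact (hp _ hC).2 i (by omega) (by omega)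

lemma cqAns_mat_iff {V : Type} {D : Interp σ14 V} {k : ℕ} (q : CQ σ14 k) (a : Fin k → V) :
    CQAns (mat D) q (root ∘ a) ↔ CertainCQ O14 D q a := by
  constructor
  · rintro ⟨h, hh, hans⟩ W ι A hA
    have := q.finV
    obtain ⟨N, hN⟩ := (Set.finite_range fun v => rimBound (h v)).bddAbove
    obtain ⟨G, hG, hGA⟩ := exists_partial_hom hA (N + 1)
    refine ⟨G ∘ h, ?_, ?_⟩
    · intro g hg
      exact hGA _ (hh g hg) fun i => Nat.lt_succ_of_le (hN ⟨_, rfl⟩)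
    · rw [Function.comp_assoc, hans]
      funext i
      exact hG _
  · intro h
    exact h _ _ _ mat_isMod

/-! ### Certain answers depend only on few facts -/

/-- A map of constants that respects an instance locally, at a fact of the materialization,
maps this fact to the materialization of the target instance. -/
lemma mat_transfer {V V' : Type} {D : Interp σ14 V} {D' : Interp σ14 V'} (ρ : V → V')
    {g : Atm σ14 (Elt V)} (hg : g ∈ mat D)
    (hdom : ∀ i, (g.2 i).1 ∈ D.dom → ρ (g.2 i).1 ∈ D'.dom)
    (hC : ∀ i, (⟨Rel14.C, ![(g.2 i).1]⟩ : Atm σ14 V) ∈ D →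
      (⟨Rel14.C, ![ρ (g.2 i).1]⟩ : Atm σ14 V') ∈ D')
    (hfact : mapAtm Prod.fst g ∈ D → mapAtm (ρ ∘ Prod.fst) g ∈ D') :
    mapAtm (Prod.map ρ id) g ∈ mat D' := by
  have act : ∀ i s, Act D (g.2 i).1 s → Act D' (ρ (g.2 i).1) s := by
    intro i s h
    cases s with
    | root => exact hdom i h
    | bad => exact hdom i h
    | rim j => exact ⟨hdom i h.1, hC i h.2⟩
  clear hC
  revert hg hdom act hfact
  refine atm_cases (P := fun g => g ∈ mat D →
    (∀ i, (g.2 i).1 ∈ D.dom → ρ (g.2 i).1 ∈ D'.dom) →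
    (mapAtm Prod.fst g ∈ D → mapAtm (ρ ∘ Prod.fst) g ∈ D') →
    (∀ i s, Act D (g.2 i).1 s → Act D' (ρ (g.2 i).1) s) →
    mapAtm (Prod.map ρ id) g ∈ mat D') ?_ ?_ ?_ ?_ ?_ ?_ ?_ g
  · rintro x (h | h) - hf act
    · simp only [mapAtm_A] at hf ⊢
      exact MatA.base (hf h)
    · rw [mapAtm_A]
      exact MatA.tree (act (0 : Fin 1) _ h)
  · rintro x (h | h) - hf act
    · simp only [mapAtm_L] at hf ⊢
      exact MatL.base (hf h)
    · rw [mapAtm_L]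
      exact MatL.tree (act (0 : Fin 1) _ h)
  · rintro x (h | h) - hf act
    · simp only [mapAtm_R] at hf ⊢
      exact MatR.base (hf h)
    · rw [mapAtm_R]
      exact MatR.tree (act (0 : Fin 1) _ h)
  · rintro x ⟨h⟩ - hf act
    simp only [mapAtm_C] at hf ⊢
    exact MatC.base (hf h)
  · rintro x y (h | h | h) hd hf act
    · simp only [mapAtm_aux] at hf ⊢
      exact MatAux.base (hf h)
    · rw [mapAtm_aux]
      exact MatAux.tree (act (0 : Fin 2) _ h)
    · rw [mapAtm_aux]
      exact MatAux.bad (hd (0 : Fin 2) h)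
  · rintro x y (h | h | h) - hf act
    · simp only [mapAtm_gen] at hf ⊢
      exact MatGen.base (hf h)
    · rw [mapAtm_gen]
      exact MatGen.left (act (0 : Fin 2) _ h)
    · rw [mapAtm_gen]
      exact MatGen.right (act (0 : Fin 2) _ h)
  · rintro x y z (h | ⟨i, h, hC⟩) hd hf act
    · simp only [mapAtm_W] at hf ⊢
      exact MatW.base (hf h)
    · rw [mapAtm_W]
      have := act (0 : Fin 3) (.rim 0) ⟨h, hC⟩
      exact MatW.wheel i this.1 this.2

/-- Homomorphisms of instances preserve certain answers. -/
lemma CertainCQ.map {V V' : Type} {D : Interp σ14 V} {D' : Interp σ14 V'} {ρ : V → V'}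
    (hρ : IsHom D D' ρ) {k : ℕ} {q : CQ σ14 k} {a : Fin k → V} (h : CertainCQ O14 D q a) :
    CertainCQ O14 D' q (ρ ∘ a) := by
  rw [← cqAns_mat_iff] at h ⊢
  obtain ⟨h, hh, hans⟩ := h
  refine ⟨Prod.map ρ id ∘ h, ?_, ?_⟩
  · intro g hg
    refine mat_transfer ρ (hh g hg) ?_ ?_ ?_
    · rintro i ⟨g, hg, j, hj⟩
      exact ⟨_, hρ g hg, j, congrArg ρ hj⟩
    · intro i hi
      simpa using isHom_iff.1 hρ _ hi
    · exact isHom_iff.1 hρ _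
  · rw [Function.comp_assoc, hans]
    rfl

/-- A certain answer depends only on boundedly many facts of the instance. -/
lemma exists_small_witness {k : ℕ} (q : CQ σ14 k) : ∃ m : ℕ, ∀ (V : Type) (D : Interp σ14 V)
    (a : Fin k → V), (∀ i, a i ∈ D.dom) → CertainCQ O14 D q a →
    ∃ f : Fin m → Option (Atm σ14 V), (∀ j g, f j = some g → g ∈ D) ∧
      (∀ i, a i ∈ Interp.dom {g | ∃ j, f j = some g}) ∧
      CertainCQ O14 {g | ∃ j, f j = some g} q a := by
  classical
  have := q.finV
  have := q.finFacts.to_subtype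
  obtain ⟨m, ⟨e⟩⟩ := Finite.exists_equiv_fin (q.V ⊕ q.V ⊕ q.facts ⊕ Fin k)
  refine ⟨m, fun V D a ha hcert => ?_⟩
  obtain ⟨h, hh, hans⟩ := (cqAns_mat_iff q a).2 hcert
  have hd : ∀ v, ∃ g : Atm σ14 V, v ∈ D.dom → g ∈ D ∧ v ∈ Interp.dom {g} := by
    intro v
    by_cases hv : v ∈ D.dom
    · obtain ⟨g, hg, i, hi⟩ := hv
      exact ⟨g, fun _ => ⟨hg, g, rfl, i, hi⟩⟩
    · exact ⟨⟨Rel14.A, ![v]⟩, fun h => absurd h hv⟩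
  choose d hd using hd
  let sel : q.V ⊕ q.V ⊕ q.facts ⊕ Fin k → Option (Atm σ14 V)
    | .inl v => if (h v).1 ∈ D.dom then some (d (h v).1) else none
    | .inr (.inl v) => if (⟨Rel14.C, ![(h v).1]⟩ : Atm σ14 V) ∈ D then
        some ⟨Rel14.C, ![(h v).1]⟩ else none
    | .inr (.inr (.inl g)) => if mapAtm (Prod.fst ∘ h) g.1 ∈ D then
        some (mapAtm (Prod.fst ∘ h) g.1) else none
    | .inr (.inr (.inr i)) => some (d (a i))
  set D' : Interp σ14 V := {g | ∃ j, sel (e.symm j) = some g} with hD'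
  have mem : ∀ s g, sel s = some g → g ∈ D' := fun s g hs => ⟨e s, by simpa using hs⟩
  have dom_mem : ∀ v, d v ∈ D' → v ∈ D.dom → v ∈ D'.dom := by
    intro v hv hv'
    obtain ⟨g, rfl, i, hi⟩ := (hd v hv').2
    exact ⟨_, hv, i, hi⟩
  refine ⟨fun j => sel (e.symm j), ?_, ?_, ?_⟩
  · suffices key : ∀ s g, sel s = some g → g ∈ D from fun j g hj => key _ g hj
    intro s g hj
    rcases s with v | v | g' | i
    · by_cases hv : (h v).1 ∈ D.dom
      · simp only [sel, if_pos hv, Option.some.injEq] at hj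
        exact hj ▸ (hd _ hv).1
      · simp [sel, hv] at hj
    · by_cases hv : (⟨Rel14.C, ![(h v).1]⟩ : Atm σ14 V) ∈ D
      · simp only [sel, if_pos hv, Option.some.injEq] at hj
        exact hj ▸ hv
      · simp [sel, hv] at hj
    · by_cases hv : mapAtm (Prod.fst ∘ h) g'.1 ∈ D
      · simp only [sel, if_pos hv, Option.some.injEq] at hj
        exact hj ▸ hv
      · simp [sel, hv] at hj
    · simp only [sel, Option.some.injEq] at hj
      exact hj ▸ (hd _ (ha i)).1
  · intro i
    exact dom_mem _ (mem (.inr (.inr (.inr i))) _ rfl) (ha i)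
  · rw [← cqAns_mat_iff]
    refine ⟨h, ?_, hans⟩
    intro g hg
    have key := mat_transfer (D' := D') id (hh g hg) ?_ ?_ ?_
    · simpa [mapAtm] using key
    · intro i hi
      exact dom_mem _ (mem (.inl (g.2 i)) _ (if_pos hi)) hi
    · intro i hi
      exact mem (.inr (.inl (g.2 i))) _ (if_pos hi)
    · intro hi
      exact mem (.inr (.inr (.inl ⟨g, hg⟩))) _ (if_pos hi)

/-! ### Deterministic computations in a given number of steps -/

/-- `Reach nx n c c'`: the partial function `nx` leads from `c` to `c'` in `n` steps. -/
inductive Reach {α : Type} (nx : α → Option α) : ℕ → α → α → Prop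
  | refl (c : α) : Reach nx 0 c c
  | head {n : ℕ} {c d e : α} (h : nx c = some d) (h' : Reach nx n d e) : Reach nx (n + 1) c e

lemma Reach.trans {α : Type} {nx : α → Option α} {n m : ℕ} {c d e : α} (h : Reach nx n c d)
    (h' : Reach nx m d e) : Reach nx (n + m) c e := by
  induction h with
  | refl => simpa using h'
  | head h1 _ ih =>
    rw [Nat.add_right_comm]
    exact .head h1 (ih h')

lemma Reach.eq_of_halt {α : Type} {nx : α → Option α} {n m : ℕ} {c d e : α}
    (h : Reach nx n c d) (hd : nx d = none) (h' : Reach nx m c e) (he : nx e = none) : d = e := by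
  induction h generalizing m with
  | refl =>
    cases h' with
    | refl => rfl
    | head h1 _ => simp [hd] at h1
  | head h1 _ ih =>
    cases h' with
    | refl => simp [he] at h1
    | head h2 h3 =>
      rw [h1, Option.some.injEq] at h2
      exact ih hd (h2 ▸ h3)

/-! ### Configurations of deterministic machines -/

section machine
variable {M : NTM}

/-- The string representing a configuration, given by the reversed part of the tape to the left
of the head, the state and the rest of the tape. -/
def cfg (c : List M.A × M.Q × List M.A) : List M.Sym :=
  c.1.reverse.map Sum.inr ++ Sum.inl c.2.1 :: c.2.2.map Sum.inr

lemma cfg_inj_of_append {u : List M.A} {q q' : M.Q} {v : List M.A} {l r : List M.Sym}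
    (h : u.map Sum.inr ++ Sum.inl q :: v.map Sum.inr = l ++ Sum.inl q' :: r) :
    l = u.map Sum.inr ∧ q' = q ∧ r = v.map Sum.inr := by
  induction u generalizing l with
  | nil =>
    cases l with
    | nil => simp_all
    | cons x l =>
      simp only [List.map_nil, List.nil_append, List.cons_append, List.cons.injEq] at h
      have : (Sum.inl q' : M.Sym) ∈ v.map Sum.inr := by simp [h.2]
      simp at this
  | cons a u ih =>
    cases l with
    | nil => simp at h
    | cons x l =>
      simp only [List.map_cons, List.cons_append, List.cons.injEq] at h
      obtain ⟨h1, h2, h3⟩ := ih h.2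
      simp [h1, h2, h3, ← h.1]

lemma mem_cfg {c : List M.A × M.Q × List M.A} {q : M.Q} (h : Sum.inl q ∈ cfg c) :
    c.2.1 = q := by
  simp [cfg] at h
  exact h.symm

lemma isConfig_cfg (c : List M.A × M.Q × List M.A) : M.IsConfig (cfg c) := by
  have : ∀ l : List M.A, (l.map (Sum.inr : M.A → M.Sym)).filter Sum.isLeft = [] := by
    intro l
    simp
  simp [NTM.IsConfig, cfg, List.filter_append, List.filter_cons, this, -List.map_reverse]

lemma initConfig_eq {S : Type} (ι : S → M.A) (w : List S) (t : ℕ) :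
    M.initConfig ι w t = cfg ([], M.q0, w.map ι ++ List.replicate t M.blank) := by
  simp [NTM.initConfig, cfg]

/-- The successor configuration of a machine with transition function `tr`. -/
def next (tr : M.Q → M.A → Option (M.Q × M.A × Bool)) :
    List M.A × M.Q × List M.A → Option (List M.A × M.Q × List M.A)
  | (_, _, []) => none
  | (u, q, a :: v) =>
    match tr q a with
    | none => none
    | some (q', b, true) => some (b :: u, q', v)
    | some (q', b, false) =>
      match u with
      | [] => none
      | c :: u => some (u, q', c :: b :: v)

variable {tr : M.Q → M.A → Option (M.Q × M.A × Bool)}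

lemma next_eq_some {c d : List M.A × M.Q × List M.A} : next tr c = some d ↔
    (∃ u q a v q' b, c = (u, q, a :: v) ∧ tr q a = some (q', b, true) ∧ d = (b :: u, q', v)) ∨
    ∃ u x q a v q' b, c = (x :: u, q, a :: v) ∧ tr q a = some (q', b, false) ∧
      d = (u, q', x :: b :: v) := by
  constructor
  · obtain ⟨u, q, v⟩ := c
    intro h
    cases v with
    | nil => simp [next] at h
    | cons a v =>
      simp only [next] at h
      split at h
      · simp at h
      · rename_i q' b h1
        left
        exact ⟨_, _, _, _, q', b, rfl, h1, (Option.some.inj h).symm⟩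
      · rename_i q' b h1
        cases u with
        | nil => simp at h
        | cons x u =>
          right
          exact ⟨_, _, _, _, _, q', b, rfl, h1, (Option.some.inj h).symm⟩
  · rintro (⟨u, q, a, v, q', b, rfl, h, rfl⟩ | ⟨u, x, q, a, v, q', b, rfl, h, rfl⟩) <;>
      simp [next, h]

lemma step_cfg_of_next (htr : ∀ q a r, r ∈ M.δ q a ↔ tr q a = some r)
    {c d : List M.A × M.Q × List M.A} (h : next tr c = some d) :
    M.Step (cfg c) (cfg d) := by
  rcases next_eq_some.1 h with ⟨u, q, a, v, q', b, rfl, h', rfl⟩ |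
    ⟨u, x, q, a, v, q', b, rfl, h', rfl⟩
  · simpa [cfg] using NTM.Step.right (u.reverse.map Sum.inr) (v.map Sum.inr) _ _ _ _
      ((htr _ _ _).2 h')
  · simpa [cfg] using NTM.Step.left (u.reverse.map Sum.inr) (v.map Sum.inr) _ _ _ _ x
      ((htr _ _ _).2 h')

lemma next_of_step_cfg (htr : ∀ q a r, r ∈ M.δ q a ↔ tr q a = some r)
    {c : List M.A × M.Q × List M.A} {l : List M.Sym} (h : M.Step (cfg c) l) :
        ∃ d, next tr c = some d ∧ l = cfg d := by
  obtain ⟨u, q, v⟩ := c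
  generalize hl : cfg (u, q, v) = l' at h
  cases h with
  | right u' v' q₁ q' a b h =>
    obtain ⟨h1, h2, h3⟩ := cfg_inj_of_append (u := u.reverse) (v := v) (l := u')
      (r := Sum.inr a :: v') (q' := q₁) (by simpa [cfg] using hl)
    cases v with
    | nil => simp at h3
    | cons a₁ v =>
      simp only [List.map_cons, List.cons.injEq, Sum.inr.injEq] at h3
      obtain ⟨rfl, rfl⟩ := h3
      subst h1 h2
      refine ⟨(b :: u, q', v), next_eq_some.2 (Or.inl ⟨_, _, _, _, _, _, rfl,
        (htr _ _ _).1 h, rfl⟩), ?_⟩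
      simp [cfg]
  | left u' v' q₁ q' a b x h =>
    obtain ⟨h1, h2, h3⟩ := cfg_inj_of_append (u := u.reverse) (v := v)
      (l := u' ++ [Sum.inr x]) (r := Sum.inr a :: v') (q' := q₁) (by simpa [cfg] using hl)
    cases v with
    | nil => simp at h3
    | cons a₁ v =>
      simp only [List.map_cons, List.cons.injEq, Sum.inr.injEq] at h3
      obtain ⟨rfl, rfl⟩ := h3
      cases u with
      | nil => simp at h1
      | cons x₁ u =>
        simp only [List.reverse_cons, List.map_append, List.map_cons, List.map_nil] at h1
        obtain ⟨rfl, h4⟩ := List.append_inj' h1 rfl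
        obtain rfl : x = x₁ := Sum.inr.inj (List.cons.inj h4).1
        subst h2
        refine ⟨(u, q', x :: b :: v), next_eq_some.2 (Or.inr ⟨_, _, _, _, _, _, _, rfl,
          (htr _ _ _).1 h, rfl⟩), ?_⟩
        simp [cfg]

lemma exists_run_of_reach (htr : ∀ q a r, r ∈ M.δ q a ↔ tr q a = some r)
    {n : ℕ} {c d : List M.A × M.Q × List M.A} (h : Reach (next tr) n c d) :
        ∃ cs, M.IsRun cs ∧ cs.head? = some (cfg c) ∧
      cs.length = n + 1 ∧ cs.getLast? = some (cfg d) := by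
  induction h with
  | refl c =>
    refine ⟨[cfg c], ⟨by simp, ?_, List.isChain_singleton _⟩, rfl, rfl, rfl⟩
    simpa using isConfig_cfg c
  | @head n c d e h _ ih =>
    obtain ⟨cs, ⟨h1, h2, h3⟩, h4, h5, h6⟩ := ih
    cases cs with
    | nil => simp at h1
    | cons x cs =>
      obtain rfl : x = cfg d := by simpa using h4
      refine ⟨cfg c :: cfg d :: cs, ⟨by simp, ?_, ?_⟩, rfl, by simpa using h5,
        by simpa [List.getLast?_cons_cons] using h6⟩
      · intro y hy
        rcases List.mem_cons.1 hy with rfl | hy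
        exacts [isConfig_cfg c, h2 y hy]
      · exact List.isChain_cons_cons.2 ⟨step_cfg_of_next htr h, h3⟩

lemma reach_of_isChain (htr : ∀ q a r, r ∈ M.δ q a ↔ tr q a = some r)
    {cs : List (List M.Sym)} {c : List M.A × M.Q × List M.A}
    {l : List M.Sym} (h : cs.IsChain M.Step) (hh : cs.head? = some (cfg c))
    (hl : cs.getLast? = some l) : ∃ n d, Reach (next tr) n c d ∧ l = cfg d := by
  induction cs generalizing c with
  | nil => simp at hh
  | cons x cs ih =>
    obtain rfl : x = cfg c := by simpa using hh
    cases cs with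
    | nil =>
      obtain rfl : cfg c = l := by simpa using hl
      exact ⟨0, c, .refl c, rfl⟩
    | cons y cs =>
      obtain ⟨h1, h2⟩ := List.isChain_cons_cons.1 h
      obtain ⟨d, h3, rfl⟩ := next_of_step_cfg htr h1
      obtain ⟨n, e, h4, h5⟩ := ih h2 rfl (by simpa [List.getLast?_cons_cons] using hl)
      exact ⟨n + 1, e, .head h3 h4, h5⟩

end machine

/-! ### Machines that sweep over their input -/

section sweep
variable {K Γ : Type}

/-- One pass over the cells, from left to right: the new state and the new cells. -/
def sweep (f : K → Γ → K × Γ) : K → List Γ → K × List Γ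
  | s, [] => (s, [])
  | s, c :: l => ((sweep f (f s c).1 l).1, (f s c).2 :: (sweep f (f s c).1 l).2)

/-- `Runs f g s l n b`: starting in state `s` on the cells `l`, the verdict `b` is reached after
`n` passes, where `g` determines the start state of the next pass, or the verdict. -/
inductive Runs (f : K → Γ → K × Γ) (g : K → K ⊕ Bool) : K → List Γ → ℕ → Bool → Prop
  | halt {s l b} (h : g (sweep f s l).1 = .inr b) : Runs f g s l 1 b
  | step {s l s' n b} (h : g (sweep f s l).1 = .inl s')
      (h' : Runs f g s' (sweep f s l).2 n b) : Runs f g s l (n + 1) b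

/-- The states of a Turing machine that simulates sweeps. -/
inductive SState (K : Type) : Type
  | start
  | right (s : K)
  | left (s : K)
  | acc
  | rej

instance [Finite K] : Finite (SState K) := by
  let e : SState K → Fin 3 ⊕ K ⊕ K
    | .start => .inl 0
    | .acc => .inl 1
    | .rej => .inl 2
    | .right s => .inr (.inl s)
    | .left s => .inr (.inr s)
  refine Finite.of_injective e ?_
  rintro (_ | s | s | _ | _) (_ | t | t | _ | _) h <;> simp_all [e]

/-- The transitions of the Turing machine that simulates sweeps. A symbol consists of a flag for
the first cell and the contents of the cell. -/
def sweepTr (f : K → Γ → K × Γ) (g : K → K ⊕ Bool) (s₀ : K) :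
    SState K → Bool × Option Γ → Option (SState K × (Bool × Option Γ) × Bool)
  | .start, (_, some c) => some (.right (f s₀ c).1, (true, some (f s₀ c).2), true)
  | .right s, (b, some c) => some (.right (f s c).1, (b, some (f s c).2), true)
  | .right s, (b, none) =>
    match g s with
    | .inl s' => some (.left s', (b, none), false)
    | .inr true => some (.acc, (b, none), true)
    | .inr false => some (.rej, (b, none), true)
  | .left s, (false, some c) => some (.left s, (false, some c), false)
  | .left s, (true, some c) => some (.right (f s c).1, (true, some (f s c).2), true)
  | _, _ => none

/-- A Turing machine that simulates sweeps. -/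
def sweepTM [Finite K] [Finite Γ] (f : K → Γ → K × Γ) (g : K → K ⊕ Bool) (s₀ : K) : NTM where
  Q := SState K
  A := Bool × Option Γ
  finQ := inferInstance
  finA := inferInstance
  blank := (false, none)
  q0 := .start
  qa := .acc
  δ q a := {r | sweepTr f g s₀ q a = some r}

lemma length_sweep (f : K → Γ → K × Γ) (s : K) (l : List Γ) :
    (sweep f s l).2.length = l.length := by
  induction l generalizing s with
  | nil => rfl
  | cons c l ih => simp [sweep, ih]

variable [Finite K] [Finite Γ] {f : K → Γ → K × Γ} {g : K → K ⊕ Bool} {s₀ : K}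

/-- The successor configuration of the machine that simulates sweeps. -/
abbrev sweepNext (f : K → Γ → K × Γ) (g : K → K ⊕ Bool) (s₀ : K) :
    List (Bool × Option Γ) × SState K × List (Bool × Option Γ) →
      Option (List (Bool × Option Γ) × SState K × List (Bool × Option Γ)) :=
  next (M := sweepTM f g s₀) (sweepTr f g s₀)

/-- A cell which is not the first one. -/
def cell (c : Γ) : Bool × Option Γ := (false, some c)

lemma reach_right (s : K) (l : List Γ) (u v : List (Bool × Option Γ)) :
    Reach (sweepNext f g s₀) l.length (u, .right s, l.map cell ++ v)
      (((sweep f s l).2.map cell).reverse ++ u, .right (sweep f s l).1, v) := by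
  induction l generalizing s u with
  | nil => exact .refl _
  | cons c l ih =>
    refine .head (d := (cell (f s c).2 :: u, .right (f s c).1, l.map cell ++ v)) rfl ?_
    have := ih (f s c).1 (cell (f s c).2 :: u)
    simpa [sweep] using this

lemma reach_left (c₀ : Γ) (s : K) (u : List Γ) (q : SState K) (x y : Bool × Option Γ)
    (v : List (Bool × Option Γ)) (h : sweepTr f g s₀ q x = some (.left s, y, false)) :
    Reach (sweepNext f g s₀) (u.length + 1) (u.map cell ++ [(true, some c₀)], q, x :: v)
      ([], .left s, (true, some c₀) :: (u.reverse.map cell ++ y :: v)) := by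
  induction u generalizing q x y v with
  | nil =>
    refine .head (d := ([], .left s, (true, some c₀) :: y :: v)) ?_ (.refl _)
    exact next_eq_some.2 (Or.inr ⟨_, _, _, _, _, _, _, rfl, h, rfl⟩)
  | cons c u ih =>
    refine .head (d := (u.map cell ++ [(true, some c₀)], .left s, cell c :: y :: v)) ?_ ?_
    · exact next_eq_some.2 (Or.inr ⟨_, _, _, _, _, _, _, rfl, h, rfl⟩)
    · have := ih (.left s) (cell c) (cell c) (y :: v) rfl
      simpa using this

lemma Runs.reach {s : K} {c₀ : Γ} {l : List Γ} {n : ℕ} {b : Bool}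
    (h : Runs f g s (c₀ :: l) n b) (q : SState K) (x : Bool × Option Γ)
    (v : List (Bool × Option Γ))
    (hq : sweepTr f g s₀ q x = some (.right (f s c₀).1, (true, some (f s c₀).2), true)) :
    ∃ m ≤ n * (2 * (l.length + 1)), ∃ u,
      Reach (sweepNext f g s₀) m ([], q, x :: (l.map cell ++ (false, none) :: v))
        (u, if b then .acc else .rej, v) := by
  generalize hl : c₀ :: l = l' at h
  induction h generalizing c₀ l q x with
  | @halt s l' b h =>
    subst hl
    have h1 : Reach (sweepNext f g s₀) 1 ([], q, x :: (l.map cell ++ (false, none) :: v))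
        ([(true, some (f s c₀).2)], .right (f s c₀).1, l.map cell ++ (false, none) :: v) :=
      .head (next_eq_some.2 (Or.inl ⟨_, _, _, _, _, _, rfl, hq, rfl⟩)) (.refl _)
    have h2 := h1.trans (reach_right (f s c₀).1 l _ _)
    refine ⟨1 + l.length + 1, by omega, _, h2.trans (.head (next_eq_some.2 (Or.inl
      ⟨_, _, _, _, _, (false, none), rfl, ?_, rfl⟩)) (.refl _))⟩
    have h' : g (sweep f (f s c₀).1 l).1 = .inr b := h
    cases b <;> simp only [sweepTr, h'] <;> rfl
  | @step s l' s' n b h h' ih =>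
    subst hl
    have h1 : Reach (sweepNext f g s₀) 1 ([], q, x :: (l.map cell ++ (false, none) :: v))
        ([(true, some (f s c₀).2)], .right (f s c₀).1, l.map cell ++ (false, none) :: v) :=
      .head (next_eq_some.2 (Or.inl ⟨_, _, _, _, _, _, rfl, hq, rfl⟩)) (.refl _)
    have h2 := h1.trans (reach_right (f s c₀).1 l _ _)
    have h3 : g (sweep f (f s c₀).1 l).1 = .inl s' := h
    have h4 := reach_left (s₀ := s₀) (f s c₀).2 s' (sweep f (f s c₀).1 l).2.reverse
      (.right (sweep f (f s c₀).1 l).1) (false, none) (false, none) v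
      (show sweepTr f g s₀ (.right _) (false, none) = _ by simp only [sweepTr, h3])
    rw [List.map_reverse] at h4
    have h5 := h2.trans h4
    obtain ⟨m, hm, u, h6⟩ := ih (c₀ := (f s c₀).2) (l := (sweep f (f s c₀).1 l).2) (.left s')
      (true, some (f s c₀).2) rfl rfl
    rw [List.reverse_reverse] at h5
    refine ⟨_, ?_, u, h5.trans h6⟩
    rw [List.length_reverse, length_sweep]
    rw [length_sweep] at hm
    nlinarith

/-- Languages decided with polynomially many passes are in PTime. -/
theorem inP_of_runs {S : Type} {L : Set (List S)} (f : K → Γ → K × Γ) (g : K → K ⊕ Bool)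
    (s₀ : K) (ι : S → Γ) (hι : Function.Injective ι) (P : Polynomial ℕ) (hnil : [] ∉ L)
    (h : ∀ w, w ≠ [] → ∃ n ≤ P.eval w.length, ∃ b, Runs f g s₀ (w.map ι) n b ∧
      (b = true ↔ w ∈ L)) : InP L := by
  have htr : ∀ q a r, r ∈ (sweepTM f g s₀).δ q a ↔ sweepTr f g s₀ q a = some r :=
    fun _ _ _ => Iff.rfl
  refine ⟨sweepTM f g s₀, ?_, fun a => cell (ι a), ?_, 2 * Polynomial.X * P + 1, ?_⟩
  · intro q a r hr r' hr'
    exact Option.some.inj (hr.symm.trans hr')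
  · intro a b hab
    exact hι (Option.some.inj (congrArg Prod.snd hab))
  · intro w
    set t := (2 * Polynomial.X * P + 1).eval w.length with ht
    have ht' : t = 2 * w.length * P.eval w.length + 1 := by simp [ht]
    have hstart : (sweepTM f g s₀).initConfig (fun a => cell (ι a)) w t =
        cfg (M := sweepTM f g s₀) ([], SState.start,
          (w.map ι).map cell ++ List.replicate t (false, none)) := by
      rw [List.map_map]
      exact initConfig_eq (M := sweepTM f g s₀) (fun a => cell (ι a)) w t
    have hhalt : ∀ (u : List (Bool × Option Γ)) (b : Bool) (v : List (Bool × Option Γ)),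
        sweepNext f g s₀ (u, if b then .acc else .rej, v) = none := by
      intro u b v
      rw [Option.eq_none_iff_forall_ne_some]
      intro d hd
      rcases next_eq_some.1 hd with ⟨_, _, _, _, _, _, h1, h2, -⟩ |
        ⟨_, _, _, _, _, _, _, h1, h2, -⟩ <;>
      · obtain rfl := (Prod.mk.inj (Prod.mk.inj h1).2).1
        cases b <;> simp [sweepTr] at h2
    constructor
    · intro hw
      have hw0 : w ≠ [] := by rintro rfl; exact hnil hw
      obtain ⟨n, hn, b, hr, hb⟩ := h w hw0
      obtain rfl := hb.2 hw
      obtain ⟨a, w, rfl⟩ := List.exists_cons_of_ne_nil hw0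
      obtain ⟨m, hm, u, hu⟩ := hr.reach (s₀ := s₀) .start (cell (ι a))
        (List.replicate (t - 1) (false, none)) rfl
      obtain ⟨cs, h1, h2, h3, h4⟩ := exists_run_of_reach htr hu
      refine ⟨cs, h1, ?_, ?_, _, h4, ?_⟩
      · rw [h2, hstart]
        obtain ⟨t', ht''⟩ : ∃ t', t = t' + 1 := ⟨_, ht'⟩
        rw [ht'']
        rfl
      · rw [h3, ht']
        simp only [List.length_map, List.length_cons] at hm hn ⊢
        nlinarith
      · exact List.mem_append_right _ (List.mem_cons_self ..)
    · rintro ⟨cs, ⟨-, -, h1⟩, h2, -, l, h3, h4⟩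
      rw [hstart] at h2
      obtain ⟨m, d, h5, rfl⟩ := reach_of_isChain htr h1 h2 h3
      have h6 := mem_cfg h4
      obtain ⟨u', q', v'⟩ := d
      obtain rfl : q' = .acc := h6
      have hw0 : w ≠ [] := by
        rintro rfl
        cases h5 with
        | head h5 =>
          rcases next_eq_some.1 h5 with ⟨_, _, _, _, _, _, h7, h8, -⟩ |
            ⟨_, _, _, _, _, _, _, h7, h8, -⟩ <;>
          · obtain ⟨h9, h10⟩ := Prod.mk.inj (Prod.mk.inj h7).2
            have h11 := List.eq_of_mem_replicate (h10.symm ▸ List.mem_cons_self ..)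
            subst h9
            rw [h11] at h8
            simp [sweepTr] at h8
      obtain ⟨n, hn, b, hr, hb⟩ := h w hw0
      refine hb.1 ?_
      obtain ⟨a, w, rfl⟩ := List.exists_cons_of_ne_nil hw0
      obtain ⟨m', hm, u, hu⟩ := hr.reach (s₀ := s₀) .start (cell (ι a))
        (List.replicate (t - 1) (false, none)) rfl
      obtain ⟨t', ht''⟩ : ∃ t', t = t' + 1 := ⟨_, ht'⟩
      rw [ht''] at h5 hu
      have := h5.eq_of_halt (hhalt u' true v') hu (hhalt u b _)
      have h7 := (Prod.mk.inj (Prod.mk.inj this).2).1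
      cases b
      · simp at h7
      · rfl

end sweep

/-! ### Multi-head automata -/

section heads
variable {K ι S : Type}

/-- The possible new positions of a head: the start of the word, the position of a head, or the
position next to a head. -/
inductive Mv (ι : Type) : Type
  | zero
  | copy (i : ι)
  | next (i : ι)

instance [Finite ι] : Finite (Mv ι) := by
  let e : Mv ι → Option (ι ⊕ ι)
    | .zero => none
    | .copy i => some (.inl i)
    | .next i => some (.inr i)
  refine Finite.of_injective e ?_
  rintro (_ | s | s) (_ | t | t) h <;> simp_all [e]

/-- The new position of a head. The position of a head is represented by the rest of the word. -/
def Mv.pos (w : List S) (h : ι → List S) : Mv ι → List S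
  | .zero => w
  | .copy i => h i
  | .next i => (h i).tail

/-- The multi-head automaton `δ` on the word `w` leads from the state `s` and the heads `h` to the
verdict `b` in `n` steps. -/
inductive HRunIn (δ : K → (ι → Option S) → K × (ι → Mv ι) ⊕ Bool) (w : List S) (b : Bool) :
    ℕ → K → (ι → List S) → Prop
  | halt {s h} (hs : δ s (fun i => (h i).head?) = .inr b) : HRunIn δ w b 1 s h
  | step {n s h s' c} (hs : δ s (fun i => (h i).head?) = .inl (s', c))
      (h' : HRunIn δ w b n s' fun i => (c i).pos w h) : HRunIn δ w b (n + 1) s h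

/-- The multi-head automaton `δ` leads to the verdict `b`. -/
def HRun (δ : K → (ι → Option S) → K × (ι → Mv ι) ⊕ Bool) (w : List S) (b : Bool) (s : K)
    (h : ι → List S) : Prop := ∃ n, HRunIn δ w b n s h

variable {δ : K → (ι → Option S) → K × (ι → Mv ι) ⊕ Bool} {w : List S} {b : Bool}

lemma HRun.halt {s : K} {h : ι → List S} (hs : δ s (fun i => (h i).head?) = .inr b) :
    HRun δ w b s h := ⟨1, .halt hs⟩

lemma HRun.step {s s' : K} {h : ι → List S} {c : ι → Mv ι}
    (hs : δ s (fun i => (h i).head?) = .inl (s', c))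
    (h' : HRun δ w b s' fun i => (c i).pos w h) : HRun δ w b s h :=
  h'.elim fun n hn => ⟨n + 1, .step hs hn⟩

lemma HRunIn.time_unique {s : K} {h : ι → List S} {n m : ℕ} (h₁ : HRunIn δ w b n s h)
    (h₂ : HRunIn δ w b m s h) : n = m := by
  induction h₁ generalizing m with
  | halt hs =>
    cases h₂ with
    | halt _ => rfl
    | step hs' _ => simp [hs] at hs'
  | step hs _ ih =>
    cases h₂ with
    | halt hs' => simp [hs] at hs'
    | step hs' h' =>
      rw [hs, Sum.inl.injEq, Prod.mk.injEq] at hs'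
      obtain ⟨rfl, rfl⟩ := hs'
      rw [ih h']

lemma Mv.pos_suffix {h : ι → List S} (hh : ∀ i, h i <:+ w) (c : Mv ι) : c.pos w h <:+ w := by
  cases c with
  | zero => exact List.suffix_rfl
  | copy i => exact hh i
  | next i => exact (List.tail_suffix _).trans (hh i)

lemma HRunIn.exists_of_le {s : K} {h : ι → List S} {n : ℕ} (h₁ : HRunIn δ w b n s h)
    (hh : ∀ i, h i <:+ w) {m : ℕ} (hm : 1 ≤ m) (hmn : m ≤ n) :
    ∃ s' h', (∀ i, h' i <:+ w) ∧ HRunIn δ w b m s' h' := by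
  induction h₁ with
  | halt hs =>
    obtain rfl : m = 1 := by omega
    exact ⟨_, _, hh, .halt hs⟩
  | @step n s h s' c hs h' ih =>
    rcases hmn.lt_or_eq with hlt | rfl
    · exact ih (fun i => Mv.pos_suffix hh _) (by omega)
    · exact ⟨_, _, hh, .step hs h'⟩

lemma HRunIn.le_card [Fintype K] [Fintype ι] [DecidableEq ι] {s : K} {h : ι → List S} {n : ℕ}
    (h₁ : HRunIn δ w b n s h) (hh : ∀ i, h i <:+ w) :
    n ≤ Fintype.card K * (w.length + 1) ^ Fintype.card ι := by
  have key : ∀ m : Fin n, ∃ d : K × (ι → Fin (w.length + 1)),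
      HRunIn δ w b (m + 1) d.1 fun i => w.drop (d.2 i) := by
    intro m
    obtain ⟨s', h', h2, h3⟩ := h₁.exists_of_le hh (m := m + 1) (by omega) m.2
    refine ⟨(s', fun i => ⟨w.length - (h' i).length, by omega⟩), ?_⟩
    convert h3 using 2 with i
    exact (List.suffix_iff_eq_drop.1 (h2 _)).symm
  choose d hd using key
  have hinj : Function.Injective d := by
    intro m m' hmm
    have h2 := hd m
    rw [hmm] at h2
    exact Fin.ext (Nat.succ_injective (h2.time_unique (hd m')))
  simpa using Fintype.card_le_of_injective d hinj

/-- The state of a sweep that simulates a multi-head automaton: its state, the moves to be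
performed, the marks of the previous cell, whether the sweep is at the first cell, and the symbols
read so far. -/
abbrev HState (K ι S : Type) : Type := K × (ι → Mv ι) × (ι → Bool) × Bool × (ι → Option S)

/-- The new mark of a cell for a head. -/
def newMark (cr mk : ι → Bool) (first : Bool) : Mv ι → Bool
  | .zero => first
  | .copy i => mk i
  | .next i => cr i

/-- The action of a sweep that simulates a multi-head automaton. -/
def hSweep (q : HState K ι S) (a : S × (ι → Bool)) : HState K ι S × (S × (ι → Bool)) :=
  ((q.1, q.2.1, a.2, false, fun i =>
    if newMark q.2.2.1 a.2 q.2.2.2.1 (q.2.1 i) then some a.1 else q.2.2.2.2 i),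
    (a.1, fun i => newMark q.2.2.1 a.2 q.2.2.2.1 (q.2.1 i)))

/-- The initial state of a sweep. -/
def hInit (s : K) (c : ι → Mv ι) : HState K ι S :=
  (s, c, fun _ => false, true, fun _ => none)

/-- The transition between sweeps that simulate a multi-head automaton. -/
def hNext (δ : K → (ι → Option S) → K × (ι → Mv ι) ⊕ Bool) (q : HState K ι S) :
    HState K ι S ⊕ Bool :=
  match δ q.1 q.2.2.2.2 with
  | .inl (s, c) => .inl (hInit s c)
  | .inr b => .inr b

/-- The cells of a word on which the positions of the heads are marked. -/
def marked (h : ι → List S) : List S → List (S × (ι → Bool))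
  | [] => []
  | a :: l => (a, fun i => decide ((h i).length = l.length + 1)) :: marked h l

lemma newMark_eq {h : ι → List S} {l : List S} {cr : ι → Bool} {first : Bool}
    (hcr : ∀ i, cr i = decide ((h i).length = l.length + 2))
    (hf : first = decide (w.length = l.length + 1)) (c : Mv ι) :
    newMark cr (fun i => decide ((h i).length = l.length + 1)) first c =
      decide ((c.pos w h).length = l.length + 1) := by
  cases c with
  | zero => exact hf
  | copy i => rfl
  | next i =>
    simp only [newMark, hcr, Mv.pos, List.length_tail, decide_eq_decide]
    omega

lemma sweep_marked {h : ι → List S} (hh : ∀ i, h i <:+ w) (s : K) (c : ι → Mv ι) (l : List S)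
    (hl : l <:+ w) (cr : ι → Bool) (hcr : ∀ i, cr i = decide ((h i).length = l.length + 1))
    (first : Bool) (hf : first = decide (w.length = l.length)) (rd : ι → Option S) :
    (sweep hSweep (s, c, cr, first, rd) (marked h l)).2 =
        marked (fun i => (c i).pos w h) l ∧
      (sweep hSweep (s, c, cr, first, rd) (marked h l)).1.1 = s ∧
      ∀ i, (sweep hSweep (s, c, cr, first, rd) (marked h l)).1.2.2.2.2 i =
        if 0 < ((c i).pos w h).length ∧ ((c i).pos w h).length ≤ l.length
          then ((c i).pos w h).head? else rd i := by
  induction l generalizing cr first rd with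
  | nil =>
    refine ⟨rfl, rfl, fun i => ?_⟩
    rw [if_neg (by rintro ⟨h4, h5⟩; simp only [List.length_nil] at h5; omega)]
    rfl
  | cons a l ih =>
    have hmk := fun i => newMark_eq (w := w) hcr hf (c i)
    have hl' : l <:+ w := (List.suffix_cons a l).trans hl
    have hlen := hl.length_le
    obtain ⟨h1, h2, h3⟩ := ih hl' (fun i => decide ((h i).length = l.length + 1)) (fun _ => rfl)
      false (by simp at hlen ⊢; omega)
      (fun i => if decide (((c i).pos w h).length = l.length + 1) then some a else rd i)
    simp only [marked, sweep, hSweep, hmk]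
    refine ⟨by rw [h1], h2, fun i => ?_⟩
    rw [h3]
    by_cases hi : ((c i).pos w h).length = l.length + 1
    · have he : (c i).pos w h = a :: l :=
        (List.suffix_of_suffix_length_le (Mv.pos_suffix hh (c i)) hl (by simp [hi])).eq_of_length
          (by simp [hi])
      simp [he]
    · simp only [hi, decide_false, Bool.false_eq_true, if_false, List.length_cons]
      congr 1
      rw [eq_iff_iff]
      constructor <;> rintro ⟨h4, h5⟩ <;> exact ⟨h4, by omega⟩

lemma sweep_hInit {h : ι → List S} (hh : ∀ i, h i <:+ w) (s : K) (c : ι → Mv ι) :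
    (sweep hSweep (hInit s c) (marked h w)).2 = marked (fun i => (c i).pos w h) w ∧
      hNext δ (sweep hSweep (hInit s c) (marked h w)).1 =
        match δ s (fun i => ((c i).pos w h).head?) with
        | .inl (s, c) => .inl (hInit s c)
        | .inr b => .inr b := by
  obtain ⟨h1, h2, h3⟩ := sweep_marked hh s c w List.suffix_rfl (fun _ => false)
    (fun i => by have := (hh i).length_le; simp; omega) true (by simp) (fun _ => none)
  refine ⟨h1, ?_⟩
  have h4 : (sweep hSweep (hInit s c) (marked h w)).1.2.2.2.2 =
      fun i => ((c i).pos w h).head? := by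
    funext i
    refine (h3 i).trans ?_
    have := (Mv.pos_suffix hh (c i)).length_le
    split_ifs with h5
    · rfl
    · have : ((c i).pos w h).length = 0 := by omega
      simp [List.length_eq_zero_iff.1 this]
  have h5 : (sweep hSweep (hInit s c) (marked h w)).1.1 = s := h2
  rw [hNext, h4, h5]

lemma HRunIn.runs {s : K} {h h₀ : ι → List S} {n : ℕ} {c : ι → Mv ι} (hr : HRunIn δ w b n s h)
    (hh : ∀ i, h₀ i <:+ w) (hc : h = fun i => (c i).pos w h₀) :
    Runs hSweep (hNext δ) (hInit s c) (marked h₀ w) n b := by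
  induction hr generalizing h₀ c with
  | halt hs =>
    subst hc
    refine .halt ?_
    rw [(sweep_hInit hh _ c).2, hs]
  | @step n s h s' c' hs _ ih =>
    subst hc
    refine .step (s' := hInit s' c') ?_ ?_
    · rw [(sweep_hInit hh _ c).2, hs]
    · rw [(sweep_hInit (δ := δ) hh _ c).1]
      exact ih (fun i => Mv.pos_suffix hh _) rfl

lemma marked_nil (l : List S) :
    marked (fun _ : ι => []) l = l.map fun a => (a, fun _ => false) := by
  induction l with
  | nil => rfl
  | cons a l ih => simp [marked, ih]

/-- Languages decided by multi-head automata are in PTime. -/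
theorem inP_of_hRun [Finite K] [Finite ι] [Finite S] {L : Set (List S)}
    (δ : K → (ι → Option S) → K × (ι → Mv ι) ⊕ Bool) (s₀ : K) (hnil : [] ∉ L)
    (h : ∀ w, ∃ b, HRun δ w b s₀ (fun _ => w) ∧ (b = true ↔ w ∈ L)) : InP L := by
  classical
  have := Fintype.ofFinite K
  have := Fintype.ofFinite ι
  refine inP_of_runs hSweep (hNext δ) (hInit s₀ fun _ => .zero) (fun a => (a, fun _ => false)) ?_
    (Polynomial.C (Fintype.card K) * (Polynomial.X + 1) ^ Fintype.card ι) hnil ?_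
  · intro a a' h
    exact congrArg Prod.fst h
  · intro w _
    obtain ⟨b, ⟨n, hn⟩, hb⟩ := h w
    refine ⟨n, ?_, b, ?_, hb⟩
    · simpa using hn.le_card fun _ => List.suffix_rfl
    · rw [← marked_nil]
      exact hn.runs (fun _ => List.nil_suffix) rfl

end heads

/-! ### A search by multi-head automata -/

section search

/-- The alphabet of inputs. -/
abbrev Sy : Type := Fin 8 ⊕ Bool

/-- Skips `n` tokens. -/
def skipTok : ℕ → List Sy → List Sy
  | 0, l => l
  | _ + 1, [] => []
  | n + 1, .inr _ :: l => skipTok (n + 1) l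
  | n + 1, .inl _ :: l => skipTok n l

/-- The bits before the end of the current token. -/
def takeBits : List Sy → List Bool
  | .inr b :: l => b :: takeBits l
  | _ => []

/-- Whether a word consists of `n` tokens, where `ok` tells whether the first token may end right
now. -/
def tokensOk : ℕ → Bool → List Sy → Bool
  | n, _, [] => n = 0
  | 0, _, _ :: _ => false
  | n + 1, _, .inr b :: l => tokensOk (n + 1) b l
  | n + 1, ok, .inl a :: l => if a = 7 ∧ ok then tokensOk n true l else false

/-- The number of arguments of the relation symbol with a given code. -/
def arity (a : Fin 8) : ℕ := if a = 6 then 3 else if a = 4 ∨ a = 5 then 2 else 1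

/-- Parses a list of facts and a list of `k` tokens, where `n` arguments of the current fact are
missing, and `ok` tells whether the current token may end right now. The result is the position
at which the list of tokens starts. -/
def parse (k : ℕ) : ℕ → Bool → List Sy → Option (List Sy)
  | _, _, [] => none
  | 0, _, .inl a :: l =>
    if a = 7 then (if tokensOk k true l then some (.inl a :: l) else none)
    else parse k (arity a) true l
  | 0, _, .inr _ :: _ => none
  | n + 1, _, .inr b :: l => parse k (n + 1) b l
  | n + 1, ok, .inl a :: l => if a = 7 ∧ ok then parse k n true l else none

lemma arity_lt (a : Fin 8) : arity a < 4 := by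
  unfold arity
  split_ifs <;> omega

/-- The heads: `y` checks the format of the input, `sep` is the position at which the list of
tokens starts, `x j` are the candidates, and `z i` are the positions of tokens. -/
inductive Hd (m : ℕ) (I : Type) : Type
  | y
  | sep
  | x (j : Fin m)
  | z (i : I)

/-- The states of the search. -/
inductive St (k m N : ℕ) (I : Type) : Type
  | facts (n : Fin 4) (ok : Bool)
  | tokens (n : Fin (k + 1)) (ok : Bool)
  | start
  | nav (rels : Fin m → Option Sy) (c : I → Fin (N + 1))
  | cmp (rels : Fin m → Option Sy) (eq : I → I → Bool)
  | inc (j : Fin (m + 1))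

variable {k m N : ℕ} {I : Type}

instance [Finite I] : Finite (Hd m I) := by
  let e : Hd m I → Bool ⊕ Fin m ⊕ I
    | .y => .inl true
    | .sep => .inl false
    | .x j => .inr (.inl j)
    | .z i => .inr (.inr i)
  refine Finite.of_injective e ?_
  rintro (_ | _ | s | s) (_ | _ | t | t) h <;> simp_all [e]

instance [Finite I] : Finite (St k m N I) := by
  let e : St k m N I → (Fin 4 × Bool) ⊕ (Fin (k + 1) × Bool) ⊕ Unit ⊕
      ((Fin m → Option Sy) × (I → Fin (N + 1))) ⊕ ((Fin m → Option Sy) × (I → I → Bool)) ⊕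
      Fin (m + 1)
    | .facts n ok => .inl (n, ok)
    | .tokens n ok => .inr (.inl (n, ok))
    | .start => .inr (.inr (.inl ()))
    | .nav r c => .inr (.inr (.inr (.inl (r, c))))
    | .cmp r c => .inr (.inr (.inr (.inr (.inl (r, c)))))
    | .inc j => .inr (.inr (.inr (.inr (.inr j))))
  refine Finite.of_injective e ?_
  rintro (_ | _ | _ | _ | _ | _) (_ | _ | _ | _ | _ | _) h <;> simp_all [e]

/-- The tuple of the data of all heads. -/
def hd {T : Type} (y s : T) (x : Fin m → T) (z : I → T) : Hd m I → T
  | .y => y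
  | .sep => s
  | .x j => x j
  | .z i => z i

/-- The bit read at a position. -/
def bitOf : Option Sy → Option Bool
  | some (.inr b) => some b
  | _ => none

/-- The number of tokens that remain to be skipped. -/
def navCount (c : Fin (N + 1)) : Option Sy → Fin (N + 1)
  | none => 0
  | some (.inl _) => ⟨c - 1, by omega⟩
  | some (.inr _) => c

/-- The position of a source of tokens. -/
def source {T : Type} (s : T) (x : Fin m → T) : Option (Fin m) → T
  | none => s
  | some j => x j

open Classical in
/-- The transition function of the search. -/
noncomputable def searchStep (src : I → Option (Fin m)) (cnt : I → Fin (N + 1))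
    (Good : (Fin m → Option Sy) → (I → I → Bool) → Prop) :
    St k m N I → (Hd m I → Option Sy) → St k m N I × (Hd m I → Mv (Hd m I)) ⊕ Bool
  | .facts n ok, r =>
    match r .y with
    | none => .inr false
    | some (.inr b) => if n = 0 then .inr false else
        .inl (.facts n b, hd (.next .y) (.next .y) (.copy ∘ .x) (.copy ∘ .z))
    | some (.inl a) =>
      if n = 0 then
        if a = 7 then .inl (.tokens ⟨k, by omega⟩ true,
          hd (.next .y) (.copy .y) (.copy ∘ .x) (.copy ∘ .z))
        else .inl (.facts ⟨arity a, arity_lt a⟩ true,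
          hd (.next .y) (.next .y) (.copy ∘ .x) (.copy ∘ .z))
      else if a = 7 ∧ ok then .inl (.facts ⟨n - 1, by omega⟩ true,
        hd (.next .y) (.next .y) (.copy ∘ .x) (.copy ∘ .z))
      else .inr false
  | .tokens n ok, r =>
    match r .y with
    | none => if n = 0 then .inl (.start, hd (.copy .y) (.copy .sep) (.copy ∘ .x) (.copy ∘ .z))
        else .inr false
    | some (.inr b) => if n = 0 then .inr false else
        .inl (.tokens n b, hd (.next .y) (.copy .sep) (.copy ∘ .x) (.copy ∘ .z))
    | some (.inl a) =>
      if n ≠ 0 ∧ a = 7 ∧ ok then .inl (.tokens ⟨n - 1, by omega⟩ true,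
        hd (.next .y) (.copy .sep) (.copy ∘ .x) (.copy ∘ .z))
      else .inr false
  | .start, r => .inl (.nav (fun j => r (.x j)) cnt, hd (.copy .y) (.copy .sep) (.copy ∘ .x)
      fun i => .copy (source .sep .x (src i)))
  | .nav rels c, r =>
    if ∀ i, c i = 0 then
      .inl (.cmp rels fun _ _ => true, hd (.copy .y) (.copy .sep) (.copy ∘ .x) (.copy ∘ .z))
    else .inl (.nav rels fun i => navCount (c i) (r (.z i)),
      hd (.copy .y) (.copy .sep) (.copy ∘ .x)
        fun i => if c i = 0 then .copy (.z i) else .next (.z i))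
  | .cmp rels eq, r =>
    if ∀ i, bitOf (r (.z i)) = none then
      if Good rels eq then .inr true
      else .inl (.inc 0, hd (.copy .y) (.copy .sep) (.copy ∘ .x) (.copy ∘ .z))
    else .inl (.cmp rels fun i i' => eq i i' && decide (bitOf (r (.z i)) = bitOf (r (.z i'))),
      hd (.copy .y) (.copy .sep) (.copy ∘ .x)
        fun i => if bitOf (r (.z i)) = none then .copy (.z i) else .next (.z i))
  | .inc j, r =>
    if h : j.1 < m then
      if r (.x ⟨j, h⟩) = none then .inl (.inc ⟨j + 1, by omega⟩,
        hd (.copy .y) (.copy .sep) (Function.update (.copy ∘ .x) ⟨j, h⟩ .zero) (.copy ∘ .z))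
      else .inl (.start, hd (.copy .y) (.copy .sep)
        (Function.update (.copy ∘ .x) ⟨j, h⟩ (.next (.x ⟨j, h⟩))) (.copy ∘ .z))
    else .inr false

variable {src : I → Option (Fin m)} {cnt : I → Fin (N + 1)}
  {Good : (Fin m → Option Sy) → (I → I → Bool) → Prop} {w y sp : List Sy}
  {x : Fin m → List Sy} {b : Bool}

/-- The search has the verdict `b`. -/
def Verdict (src : I → Option (Fin m)) (cnt : I → Fin (N + 1))
    (Good : (Fin m → Option Sy) → (I → I → Bool) → Prop) (w : List Sy) (b : Bool)
    (s : St k m N I) (y sp : List Sy) (x : Fin m → List Sy) (z : I → List Sy) : Prop :=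
  HRun (searchStep src cnt Good) w b s (hd y sp x z)

lemma verdict_step {s s' : St k m N I} {z : I → List Sy} {cy cs : Mv (Hd m I)}
    {cx : Fin m → Mv (Hd m I)} {cz : I → Mv (Hd m I)}
    (hs : searchStep src cnt Good s (fun i => (hd y sp x z i).head?) =
      .inl (s', hd cy cs cx cz))
    (h : Verdict src cnt Good w b s' (cy.pos w (hd y sp x z)) (cs.pos w (hd y sp x z))
      (fun j => (cx j).pos w (hd y sp x z)) (fun i => (cz i).pos w (hd y sp x z))) :
    Verdict src cnt Good w b s y sp x z := by
  refine HRun.step hs ?_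
  have e : (fun i => (hd cy cs cx cz i).pos w (hd y sp x z)) =
      hd (cy.pos w (hd y sp x z)) (cs.pos w (hd y sp x z))
        (fun j => (cx j).pos w (hd y sp x z)) (fun i => (cz i).pos w (hd y sp x z)) := by
    funext i
    cases i <;> rfl
  rw [e]
  exact h

lemma takeBits_eq (l : List Sy) :
    takeBits l = match bitOf l.head? with
      | none => []
      | some b => b :: takeBits l.tail := by
  rcases l with _ | ⟨a | b, l⟩ <;> rfl

lemma takeBits_eq_iff (l l' : List Sy) :
    takeBits l = takeBits l' ↔ bitOf l.head? = bitOf l'.head? ∧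
      takeBits (if bitOf l.head? = none then l else l.tail) =
        takeBits (if bitOf l'.head? = none then l' else l'.tail) := by
  rcases l with _ | ⟨a | b, l⟩ <;> rcases l' with _ | ⟨a' | b', l'⟩ <;> simp [takeBits, bitOf]

lemma verdict_cmp {rels : Fin m → Option Sy} {c : I → I → Bool}
    (n : ℕ) (z : I → List Sy) (hz : ∀ i, (takeBits (z i)).length ≤ n) :
    (Good rels (fun i i' => c i i' && decide (takeBits (z i) = takeBits (z i'))) →
      Verdict (k := k) src cnt Good w true (.cmp rels c) y sp x z) ∧
    (¬ Good rels (fun i i' => c i i' && decide (takeBits (z i) = takeBits (z i'))) →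
      (∀ z, Verdict (k := k) src cnt Good w b (.inc 0) y sp x z) →
      Verdict (k := k) src cnt Good w b (.cmp rels c) y sp x z) := by
  have hbase : ∀ (c : I → I → Bool) (z : I → List Sy), (∀ i, bitOf (z i).head? = none) →
      (Good rels (fun i i' => c i i' && decide (takeBits (z i) = takeBits (z i'))) →
        Verdict (k := k) src cnt Good w true (.cmp rels c) y sp x z) ∧
      (¬ Good rels (fun i i' => c i i' && decide (takeBits (z i) = takeBits (z i'))) →
        (∀ z, Verdict (k := k) src cnt Good w b (.inc 0) y sp x z) →
        Verdict (k := k) src cnt Good w b (.cmp rels c) y sp x z) := by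
    intro c z hb
    have h1 : ∀ i, takeBits (z i) = [] := fun i => by rw [takeBits_eq, hb]
    simp only [h1, decide_true, Bool.and_true]
    exact ⟨fun h => HRun.halt ((if_pos hb).trans (if_pos h)),
      fun h h' => verdict_step ((if_pos hb).trans (if_neg h)) (h' _)⟩
  induction n generalizing z c with
  | zero =>
    refine hbase c z fun i => ?_
    have := hz i
    rw [takeBits_eq] at this
    cases h : bitOf (z i).head? with
    | none => rfl
    | some b => simp [h] at this
  | succ n ih =>
    by_cases hb : ∀ i, bitOf (z i).head? = none
    · exact hbase c z hb
    have e : (fun i i' => c i i' && decide (takeBits (z i) = takeBits (z i'))) =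
        fun i i' => (c i i' && decide (bitOf (z i).head? = bitOf (z i').head?)) &&
          decide (takeBits (if bitOf (z i).head? = none then z i else (z i).tail) =
            takeBits (if bitOf (z i').head? = none then z i' else (z i').tail)) := by
      funext i i'
      rw [Bool.and_assoc, ← Bool.decide_and]
      simp only [← takeBits_eq_iff]
    rw [e]
    have hz' : ∀ i, (takeBits (if bitOf (z i).head? = none then z i else (z i).tail)).length ≤
        n := by
      intro i
      have := hz i
      rw [takeBits_eq] at this
      cases h : bitOf (z i).head? with
      | none => rw [if_pos rfl, takeBits_eq, h]; simp
      | some b => simpa [h] using this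
    have e' : (fun i => (if bitOf (hd y sp x z (.z i)).head? = none then .copy (.z i)
        else .next (.z i) : Mv (Hd m I)).pos w (hd y sp x z)) =
        fun i => if bitOf (z i).head? = none then z i else (z i).tail := by
      funext i
      split_ifs with h1 h2 h2
      · rfl
      · exact absurd h1 h2
      · exact absurd h2 h1
      · rfl
    refine ⟨fun h => verdict_step (if_neg hb) ?_, fun h h' => verdict_step (if_neg hb) ?_⟩
    · rw [e']
      exact (ih _ hz').1 h
    · rw [e']
      exact (ih _ hz').2 h h'

lemma verdict_nav {rels : Fin m → Option Sy} (n : ℕ) (z : I → List Sy) (c : I → Fin (N + 1))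
    (hz : ∀ i, c i = 0 ∨ (z i).length < n)
    (h : Verdict (k := k) src cnt Good w b (.cmp rels fun _ _ => true) y sp x
      fun i => skipTok (c i) (z i)) :
    Verdict (k := k) src cnt Good w b (.nav rels c) y sp x z := by
  induction n generalizing z c with
  | zero =>
    have hc : ∀ i, c i = 0 := fun i => (hz i).resolve_right (by omega)
    refine verdict_step (if_pos hc) ?_
    simp only [hc, Fin.val_zero, skipTok] at h
    exact h
  | succ n ih =>
    by_cases hc : ∀ i, c i = 0
    · refine verdict_step (if_pos hc) ?_
      simp only [hc, Fin.val_zero, skipTok] at h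
      exact h
    refine verdict_step (if_neg hc) (ih _ _ (fun i => ?_) ?_)
    · have hi := hz i
      by_cases h0 : c i = 0
      · left
        simp only [h0]
        rcases (hd y sp x z (.z i)).head? with _ | _ | _ <;> rfl
      · have hi := (hz i).resolve_left h0
        simp only [h0, if_false]
        change navCount (c i) (z i).head? = 0 ∨ (z i).tail.length < n
        rcases hl : z i with _ | ⟨a, l⟩
        · exact .inl rfl
        · rw [hl] at hi
          exact .inr (Nat.lt_of_succ_lt_succ hi)
    · convert h using 2 with i
      by_cases h0 : c i = 0
      · simp only [h0, if_true]
        have : navCount (0 : Fin (N + 1)) (hd y sp x z (.z i)).head? = 0 := by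
          rcases (hd y sp x z (.z i)).head? with _ | _ | _ <;> rfl
        rw [this]
        rfl
      · simp only [h0, if_false]
        change skipTok (navCount (c i) (z i).head?) (z i).tail = skipTok (c i) (z i)
        obtain ⟨d, hd⟩ := Nat.exists_eq_succ_of_ne_zero (Fin.val_ne_zero_iff.2 h0)
        rcases z i with _ | ⟨a | a, l⟩ <;> simp [navCount, hd, skipTok]

/-- The positions `x` pass the test. -/
def Accept (src : I → Option (Fin m)) (cnt : I → Fin (N + 1))
    (Good : (Fin m → Option Sy) → (I → I → Bool) → Prop) (sp : List Sy)
    (x : Fin m → List Sy) : Prop :=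
  Good (fun j => (x j).head?) fun i i' =>
    decide (takeBits (skipTok (cnt i) (source sp x (src i))) =
      takeBits (skipTok (cnt i') (source sp x (src i'))))

lemma exists_bound [Finite I] (f : I → ℕ) : ∃ n, ∀ i, f i < n := by
  obtain ⟨n, hn⟩ := (Set.finite_range f).bddAbove
  exact ⟨n + 1, fun i => Nat.lt_succ_of_le (hn ⟨i, rfl⟩)⟩

lemma verdict_start [Finite I] (z : I → List Sy) :
    (Accept src cnt Good sp x → Verdict (k := k) src cnt Good w true .start y sp x z) ∧
    (¬ Accept src cnt Good sp x →
      (∀ z, Verdict (k := k) src cnt Good w b (.inc 0) y sp x z) →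
      Verdict (k := k) src cnt Good w b .start y sp x z) := by
  have key : ∀ b, Verdict (k := k) src cnt Good w b (.cmp (fun j => (x j).head?)
      fun _ _ => true) y sp x (fun i => skipTok (cnt i) (source sp x (src i))) →
      Verdict (k := k) src cnt Good w b .start y sp x z := by
    intro b h
    refine verdict_step (s' := .nav (fun j => (x j).head?) cnt) rfl ?_
    obtain ⟨n, hn⟩ := exists_bound fun i => (source sp x (src i)).length
    have e : (fun i => (Mv.copy (source .sep .x (src i)) : Mv (Hd m I)).pos w (hd y sp x z)) =
        fun i => source sp x (src i) := by
      funext i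
      cases src i <;> rfl
    rw [e]
    exact verdict_nav n _ cnt (fun i => .inr (hn i)) h
  obtain ⟨n, hn⟩ := exists_bound fun i =>
    (takeBits (skipTok (cnt i) (source sp x (src i)))).length
  have h1 := verdict_cmp (k := k) (src := src) (cnt := cnt) (Good := Good) (w := w) (y := y)
    (sp := sp) (x := x) (b := b) (rels := fun j => (x j).head?) (c := fun _ _ => true) n _
    fun i => (hn i).le
  simp only [Bool.true_and] at h1
  exact ⟨fun h => key _ (h1.1 h), fun h h' => key _ (h1.2 h h')⟩

lemma verdict_search [Finite I] (j : ℕ) (hj : j ≤ m) (x : Fin m → List Sy)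
    (hx : ∀ i, i.1 < j → x i = w) (hxw : ∀ i, x i <:+ w) :
    ((∀ z, Verdict (k := k) src cnt Good w true .start y sp x z) ∧
      ∃ x', (∀ i, x' i <:+ w) ∧ Accept src cnt Good sp x') ∨
    (∀ x', (∀ i, x' i <:+ w) → (∀ i, j ≤ i.1 → x' i = x i) →
      ¬ Accept src cnt Good sp x') ∧
    ∀ b, (∀ z, Verdict (k := k) src cnt Good w b (.inc ⟨j, by omega⟩) y sp x z) →
      ∀ z, Verdict (k := k) src cnt Good w b .start y sp x z := by
  induction j generalizing x with
  | zero =>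
    by_cases h : Accept src cnt Good sp x
    · exact .inl ⟨fun z => (verdict_start (b := true) z).1 h, x, hxw, h⟩
    · refine .inr ⟨fun x' _ h2 => ?_, fun b h' z => (verdict_start z).2 h h'⟩
      rwa [show x' = x from funext fun i => h2 i (Nat.zero_le _)]
  | succ j ih =>
    have hpos : ∀ (l : List Sy) (c : Mv (Hd m I)) (z : I → List Sy),
        (fun i => (Function.update (.copy ∘ .x) ⟨j, hj⟩ c i : Mv (Hd m I)).pos w
          (hd y sp (Function.update x ⟨j, hj⟩ l) z)) =
        Function.update x ⟨j, hj⟩ (c.pos w (hd y sp (Function.update x ⟨j, hj⟩ l) z)) := by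
      intro l c z
      funext i
      by_cases hi : i = ⟨j, hj⟩
      · subst hi
        simp
      · simp [hi, Mv.pos, hd]
    have hsuf : ∀ l, l <:+ w → ∀ i, Function.update x ⟨j, hj⟩ l i <:+ w := by
      intro l hl i
      by_cases hi : i = ⟨j, hj⟩
      · subst hi
        simpa using hl
      · simpa [hi] using hxw i
    have hlow : ∀ (l : List Sy) (i : Fin m), i.1 < j → Function.update x ⟨j, hj⟩ l i = w := by
      intro l i hi
      rw [Function.update_of_ne (by rintro rfl; simp at hi)]
      exact hx i (by omega)
    have hagree : ∀ (l : List Sy) (x' : Fin m → List Sy), (∀ i, j + 1 ≤ i.1 → x' i = x i) →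
        x' ⟨j, hj⟩ = l → ∀ i, j ≤ i.1 → x' i = Function.update x ⟨j, hj⟩ l i := by
      rintro l x' h1 rfl i hi
      by_cases hi' : i = ⟨j, hj⟩
      · subst hi'
        simp
      · rw [Function.update_of_ne hi']
        exact h1 i (Nat.lt_of_le_of_ne hi fun h => hi' (Fin.ext h.symm))
    have hself : Function.update x ⟨j, hj⟩ w = x := by
      rw [← hx ⟨j, hj⟩ (Nat.lt_succ_self j)]
      exact Function.update_eq_self _ _
    have key : ∀ l, l <:+ w →
      ((∀ z, Verdict (k := k) src cnt Good w true .start y sp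
          (Function.update x ⟨j, hj⟩ l) z) ∧
        ∃ x', (∀ i, x' i <:+ w) ∧ Accept src cnt Good sp x') ∨
      (∀ x', (∀ i, x' i <:+ w) → (∀ i, j + 1 ≤ i.1 → x' i = x i) → x' ⟨j, hj⟩ <:+ l →
        ¬ Accept src cnt Good sp x') ∧
      ∀ b, (∀ z, Verdict (k := k) src cnt Good w b (.inc ⟨j + 1, by omega⟩) y sp x z) →
        ∀ z, Verdict (k := k) src cnt Good w b .start y sp (Function.update x ⟨j, hj⟩ l) z := by
      intro l hl
      induction l with
      | nil =>
        refine (ih (by omega) _ (hlow []) (hsuf [] hl)).imp id fun ⟨h1, h2⟩ => ⟨?_, ?_⟩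
        · exact fun x' h3 h4 h5 => h1 x' h3 (hagree _ x' h4 (List.suffix_nil.1 h5))
        · refine fun b h3 => h2 b fun z => verdict_step ((dif_pos hj).trans (if_pos ?_)) ?_
          · simp [hd]
          · rw [hpos]
            exact hself.symm ▸ h3 _
      | cons a l ih' =>
        have hl' := (List.suffix_cons a l).trans hl
        rcases ih (by omega) _ (hlow _) (hsuf _ hl) with h | ⟨h1, h2⟩
        · exact .inl h
        have hstep : ∀ b, (∀ z, Verdict (k := k) src cnt Good w b .start y sp
              (Function.update x ⟨j, hj⟩ l) z) →
            ∀ z, Verdict (k := k) src cnt Good w b .start y sp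
              (Function.update x ⟨j, hj⟩ (a :: l)) z := by
          refine fun b h => h2 b fun z => verdict_step ((dif_pos hj).trans (if_neg ?_)) ?_
          · simp [hd]
          · rw [hpos]
            simp only [Mv.pos, hd, Function.update_self, List.tail_cons]
            exact h _
        rcases ih' hl' with ⟨h3, h4⟩ | ⟨h3, h4⟩
        · exact .inl ⟨hstep _ h3, h4⟩
        · refine .inr ⟨fun x' h5 h6 h7 => ?_, fun b h => hstep b (h4 b h)⟩
          rcases List.suffix_cons_iff.1 h7 with h7 | h7
          · exact h1 x' h5 (hagree _ x' h6 h7)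
          · exact h3 x' h5 h6 h7
    have h := key w List.suffix_rfl
    rw [hself] at h
    exact h.imp id fun ⟨h1, h2⟩ => ⟨fun x' h3 h4 => h1 x' h3 h4 (h3 _), h2⟩

lemma searchStep_tokens (n : Fin (k + 1)) (ok : Bool) (y : List Sy) (z : I → List Sy) :
    searchStep src cnt Good (.tokens n ok) (fun i => (hd y sp x z i).head?) =
    match y.head? with
    | none => if n = 0 then .inl (.start, hd (.copy .y) (.copy .sep) (.copy ∘ .x) (.copy ∘ .z))
        else .inr false
    | some (.inr b) => if n = 0 then .inr false else
        .inl (.tokens n b, hd (.next .y) (.copy .sep) (.copy ∘ .x) (.copy ∘ .z))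
    | some (.inl a) =>
      if n ≠ 0 ∧ a = 7 ∧ ok then .inl (.tokens ⟨n - 1, by omega⟩ true,
        hd (.next .y) (.copy .sep) (.copy ∘ .x) (.copy ∘ .z))
      else .inr false := rfl

lemma verdict_tokens (n : Fin (k + 1)) (ok : Bool) (y : List Sy) (z : I → List Sy) :
    (tokensOk n ok y = true → (∀ z, Verdict (k := k) src cnt Good w b .start [] sp x z) →
      Verdict (k := k) src cnt Good w b (.tokens n ok) y sp x z) ∧
    (tokensOk n ok y = false → Verdict (k := k) src cnt Good w false (.tokens n ok) y sp x z) := by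
  induction y generalizing n ok z with
  | nil =>
    obtain ⟨_ | n, hn⟩ := n
    · exact ⟨fun _ h' => verdict_step ((searchStep_tokens ..).trans <| if_pos rfl) (h' _),
        by simp [tokensOk]⟩
    · exact ⟨by simp [tokensOk], fun _ => HRun.halt ((searchStep_tokens ..).trans <|
        if_neg (by simp))⟩
  | cons a y ih =>
    obtain ⟨_ | n, hn⟩ := n
    · refine ⟨by simp [tokensOk], fun _ => HRun.halt ?_⟩
      rcases a with a | a
      · exact (searchStep_tokens ..).trans <| if_neg (by simp)
      · exact (searchStep_tokens ..).trans <| if_pos rfl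
    · rcases a with a | a
      · by_cases h : a = 7 ∧ ok
        · have h1 := ih ⟨n, by omega⟩ true z
          simp only [tokensOk, if_pos h]
          exact ⟨fun h2 h3 => verdict_step ((searchStep_tokens ..).trans <|
              if_pos ⟨by simp, h⟩) (h1.1 h2 h3),
            fun h2 => verdict_step ((searchStep_tokens ..).trans <| if_pos ⟨by simp, h⟩) (h1.2 h2)⟩
        · simp only [tokensOk, if_neg h]
          exact ⟨by simp, fun _ => HRun.halt ((searchStep_tokens ..).trans <|
              if_neg fun h' => h h'.2)⟩
      · have h1 := ih ⟨n + 1, hn⟩ a z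
        simp only [tokensOk]
        exact ⟨fun h2 h3 => verdict_step ((searchStep_tokens ..).trans <|
            if_neg (by simp)) (h1.1 h2 h3),
          fun h2 => verdict_step ((searchStep_tokens ..).trans <| if_neg (by simp)) (h1.2 h2)⟩

lemma searchStep_facts (n : Fin 4) (ok : Bool) (y : List Sy) (z : I → List Sy) :
    searchStep (k := k) src cnt Good (.facts n ok) (fun i => (hd y sp x z i).head?) =
    match y.head? with
    | none => .inr false
    | some (.inr b) => if n = 0 then .inr false else
        .inl (.facts n b, hd (.next .y) (.next .y) (.copy ∘ .x) (.copy ∘ .z))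
    | some (.inl a) =>
      if n = 0 then
        if a = 7 then .inl (.tokens ⟨k, by omega⟩ true,
          hd (.next .y) (.copy .y) (.copy ∘ .x) (.copy ∘ .z))
        else .inl (.facts ⟨arity a, arity_lt a⟩ true,
          hd (.next .y) (.next .y) (.copy ∘ .x) (.copy ∘ .z))
      else if a = 7 ∧ ok then .inl (.facts ⟨n - 1, by omega⟩ true,
        hd (.next .y) (.next .y) (.copy ∘ .x) (.copy ∘ .z))
      else .inr false := rfl

lemma verdict_facts (n : Fin 4) (ok : Bool) (y : List Sy) (z : I → List Sy) :
    (∀ sp, parse k n ok y = some sp → (∀ z, Verdict (k := k) src cnt Good w b .start [] sp x z) →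
      Verdict (k := k) src cnt Good w b (.facts n ok) y y x z) ∧
    (parse k n ok y = none → Verdict (k := k) src cnt Good w false (.facts n ok) y y x z) := by
  induction y generalizing n ok z with
  | nil => exact ⟨by simp [parse], fun _ => HRun.halt rfl⟩
  | cons a y ih =>
    obtain ⟨_ | n, hn⟩ := n
    · rcases a with a | a
      · by_cases h : a = 7
        · simp only [parse, if_pos h]
          have h1 := fun sp b => verdict_tokens (k := k) (src := src) (cnt := cnt) (Good := Good)
            (w := w) (x := x) (sp := sp) (b := b) ⟨k, by omega⟩ true y z
          refine ⟨fun sp h2 h3 => verdict_step ((searchStep_facts ..).trans <|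
              (if_pos rfl).trans (if_pos h)) ?_,
            fun h2 => verdict_step ((searchStep_facts ..).trans <|
                (if_pos rfl).trans (if_pos h)) ?_⟩
          · split_ifs at h2 with h4
            obtain rfl := Option.some.inj h2
            exact (h1 _ _).1 h4 h3
          · split_ifs at h2 with h4
            exact (h1 _ true).2 (by simpa using h4)
        · have h1 := ih ⟨arity a, arity_lt a⟩ true z
          simp only [parse, if_neg h]
          exact ⟨fun sp h2 h3 => verdict_step ((searchStep_facts ..).trans <|
              (if_pos rfl).trans (if_neg h)) (h1.1 sp h2 h3),
            fun h2 => verdict_step ((searchStep_facts ..).trans <|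
                (if_pos rfl).trans (if_neg h)) (h1.2 h2)⟩
      · exact ⟨by simp [parse], fun _ => HRun.halt ((searchStep_facts ..).trans <| if_pos rfl)⟩
    · rcases a with a | a
      · by_cases h : a = 7 ∧ ok
        · have h1 := ih ⟨n, by omega⟩ true z
          simp only [parse, if_pos h]
          exact ⟨fun sp h2 h3 => verdict_step ((searchStep_facts ..).trans <|
              (if_neg (by simp)).trans (if_pos h)) (h1.1 sp h2 h3),
            fun h2 => verdict_step ((searchStep_facts ..).trans <|
                (if_neg (by simp)).trans (if_pos h)) (h1.2 h2)⟩
        · simp only [parse, if_neg h]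
          exact ⟨by simp, fun _ => HRun.halt ((searchStep_facts ..).trans <|
              (if_neg (by simp)).trans (if_neg h))⟩
      · have h1 := ih ⟨n + 1, hn⟩ a z
        simp only [parse]
        exact ⟨fun sp h2 h3 => verdict_step ((searchStep_facts ..).trans <|
            if_neg (by simp)) (h1.1 sp h2 h3),
          fun h2 => verdict_step ((searchStep_facts ..).trans <| if_neg (by simp)) (h1.2 h2)⟩

/-- The language of all words with a format given by `parse` for which some positions pass a test
that depends on the symbols at these positions and on the equality of tokens is in PTime. -/
theorem inP_search [Finite I] (k : ℕ) (src : I → Option (Fin m)) (cnt : I → Fin (N + 1))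
    (Good : (Fin m → Option Sy) → (I → I → Bool) → Prop) :
    InP {w | ∃ sp, parse k 0 true w = some sp ∧ ∃ x : Fin m → List Sy, (∀ j, x j <:+ w) ∧
      Accept src cnt Good sp x} := by
  refine inP_of_hRun (searchStep (k := k) src cnt Good) (.facts 0 true) ?_ fun w => ?_
  · rintro ⟨sp, h, -⟩
    simp [parse] at h
  have hw : (fun _ => w : Hd m I → List Sy) = hd w w (fun _ => w) fun _ => w := by
    funext i
    cases i <;> rfl
  rw [hw]
  cases hp : parse k 0 true w with
  | none =>
    refine ⟨false, (verdict_facts (b := false) 0 true w _).2 hp, ?_⟩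
    simp [hp]
  | some sp =>
    have key := verdict_search (k := k) (src := src) (cnt := cnt) (Good := Good) (w := w)
      (y := []) (sp := sp) m le_rfl (fun _ => w) (fun _ _ => rfl) (fun _ => List.suffix_rfl)
    rcases key with ⟨h1, x', h2, h3⟩ | ⟨h1, h2⟩
    · refine ⟨true, (verdict_facts 0 true w _).1 sp hp h1, ?_⟩
      simp only [true_iff]
      exact ⟨sp, hp, x', h2, h3⟩
    · refine ⟨false, (verdict_facts 0 true w _).1 sp hp (h2 false ?_), ?_⟩
      · exact fun z => HRun.halt (by simp [searchStep])
      · simp only [Bool.false_eq_true, false_iff]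
        rintro ⟨sp', h3, x', h4, h5⟩
        obtain rfl : sp = sp' := Option.some.inj (hp.symm.trans h3)
        exact h1 x' h4 (fun i hi => absurd i.2 (by omega)) h5

end search

/-! ### Query evaluation is in PTime -/

/-- The code of the relation symbol of a fact. -/
def rel : F14 → Fin 8
  | .fA _ => 0
  | .fL _ => 1
  | .fR _ => 2
  | .fC _ => 3
  | .faux _ _ => 4
  | .fgen _ _ => 5
  | .fW _ _ _ => 6

/-- The arguments of a fact. -/
def args : F14 → List ℕ
  | .fA a => [a]
  | .fL a => [a]
  | .fR a => [a]
  | .fC a => [a]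
  | .faux a b => [a, b]
  | .fgen a b => [a, b]
  | .fW a b c => [a, b, c]

/-- The encoding of a list of numbers. -/
def encNats (t : List ℕ) : List Sy := (t.map fun m => encNat m ++ [.inl 7]).flatten

/-- The encoding of a list of facts. -/
def encFs (Dl : List F14) : List Sy := (Dl.map fun f => encF f ++ [.inl 7]).flatten

lemma encNats_cons (a : ℕ) (t : List ℕ) :
    encNats (a :: t) = (Nat.bits a).map Sum.inr ++ .inl 7 :: encNats t := by
  simp [encNats, encNat]

lemma encF_append (f : F14) : encF f ++ [.inl 7] = .inl (rel f) :: encNats (args f) := by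
  cases f <;> simp [encF, rel, args, encNats]

lemma encFs_cons (f : F14) (Dl : List F14) :
    encFs (f :: Dl) = .inl (rel f) :: (encNats (args f) ++ encFs Dl) := by
  simp [encFs, ← List.cons_append, ← encF_append]

lemma encInput_eq (Dl : List F14) (t : List ℕ) :
    encInput Dl t = encFs Dl ++ .inl 7 :: encNats t := by
  simp [encInput, encFs, encNats]

lemma length_args (f : F14) : (args f).length = arity (rel f) := by
  cases f <;> rfl

lemma rel_ne (f : F14) : rel f ≠ 7 := by
  cases f <;> simp [rel]

lemma exists_fact {a : Fin 8} (ha : a ≠ 7) {l : List ℕ} (hl : l.length = arity a) :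
    ∃ f, rel f = a ∧ args f = l := by
  fin_cases a
  · obtain ⟨x, rfl⟩ := List.length_eq_one_iff.1 hl
    exact ⟨.fA x, rfl, rfl⟩
  · obtain ⟨x, rfl⟩ := List.length_eq_one_iff.1 hl
    exact ⟨.fL x, rfl, rfl⟩
  · obtain ⟨x, rfl⟩ := List.length_eq_one_iff.1 hl
    exact ⟨.fR x, rfl, rfl⟩
  · obtain ⟨x, rfl⟩ := List.length_eq_one_iff.1 hl
    exact ⟨.fC x, rfl, rfl⟩
  · obtain ⟨x, y, rfl⟩ := List.length_eq_two.1 hl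
    exact ⟨.faux x y, rfl, rfl⟩
  · obtain ⟨x, y, rfl⟩ := List.length_eq_two.1 hl
    exact ⟨.fgen x y, rfl, rfl⟩
  · obtain ⟨x, y, z, rfl⟩ := List.length_eq_three.1 hl
    exact ⟨.fW x y z, rfl, rfl⟩
  · simp at ha

lemma mapAtm_toAtm {f g : F14} {ρ : ℕ → ℕ} (h : rel g = rel f) (h' : args g = (args f).map ρ) :
    mapAtm ρ f.toAtm = g.toAtm := by
  cases f <;> cases g <;> simp [rel] at h <;> simp [args] at h' <;>
    simp [F14.toAtm, h']

lemma bits_injective : Function.Injective Nat.bits := fun m n h =>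
  Nat.eq_of_testBit_eq fun i => by rw [Nat.testBit_eq_inth, Nat.testBit_eq_inth, h]

/-- Binary representations have no leading zeros. -/
lemma exists_bits_eq_iff (l : List Bool) :
    (∃ m, Nat.bits m = l) ↔ l.getLast? ≠ some false := by
  constructor
  · rintro ⟨m, rfl⟩
    induction m using Nat.binaryRec' with
    | zero => simp
    | bit b n hb ih =>
      rw [Nat.bits_append_bit _ _ hb, List.getLast?_cons]
      by_cases hn : n = 0
      · simp [hn, hb hn]
      · have h' : n.bits ≠ [] := fun h => hn (bits_injective (h.trans Nat.zero_bits.symm))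
        rcases h : n.bits.getLast? with _ | _ | _ <;> simp_all
  · intro h
    induction l with
    | nil => exact ⟨0, rfl⟩
    | cons b l ih =>
      rw [List.getLast?_cons] at h
      obtain ⟨m, rfl⟩ := ih fun h' => h (by rw [h']; rfl)
      refine ⟨Nat.bit b m, Nat.bits_append_bit _ _ ?_⟩
      rintro rfl
      simpa using h

/-! #### The format -/

lemma tokensOk_bits (n : ℕ) (ok : Bool) (bs : List Bool) (l : List Sy)
    (h : bs.getLast?.getD ok = true) :
    tokensOk (n + 1) ok (bs.map Sum.inr ++ .inl 7 :: l) = tokensOk n true l := by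
  induction bs generalizing ok with
  | nil => simp_all [tokensOk]
  | cons b bs ih =>
    rw [List.getLast?_cons] at h
    exact ih b h

lemma parse_bits (k n : ℕ) (ok : Bool) (bs : List Bool) (l : List Sy)
    (h : bs.getLast?.getD ok = true) :
    parse k (n + 1) ok (bs.map Sum.inr ++ .inl 7 :: l) = parse k n true l := by
  induction bs generalizing ok with
  | nil => simp_all [parse]
  | cons b bs ih =>
    rw [List.getLast?_cons] at h
    exact ih b h

lemma getLast_bits (m : ℕ) : (Nat.bits m).getLast?.getD true = true := by
  have h := (exists_bits_eq_iff (Nat.bits m)).1 ⟨m, rfl⟩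
  rcases h' : (Nat.bits m).getLast? with _ | _ | _ <;> simp_all

lemma tokensOk_encNats (t : List ℕ) : tokensOk t.length true (encNats t) = true := by
  induction t with
  | nil => rfl
  | cons a t ih => rwa [encNats_cons, List.length_cons, tokensOk_bits _ _ _ _ (getLast_bits a)]

lemma parse_encNats (k : ℕ) (t : List ℕ) (l : List Sy) :
    parse k t.length true (encNats t ++ l) = parse k 0 true l := by
  induction t with
  | nil => rfl
  | cons a t ih =>
    rwa [encNats_cons, List.length_cons, List.append_assoc, List.cons_append,
      parse_bits _ _ _ _ _ (getLast_bits a)]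

lemma parse_encInput (Dl : List F14) (t : List ℕ) :
    parse t.length 0 true (encFs Dl ++ .inl 7 :: encNats t) = some (.inl 7 :: encNats t) := by
  induction Dl with
  | nil => simp [encFs, parse, tokensOk_encNats]
  | cons f Dl ih =>
    rw [encFs_cons, List.cons_append, parse, if_neg (rel_ne f), ← length_args, List.append_assoc,
      parse_encNats, ih]

lemma exists_of_tokensOk (l : List Sy) (n : ℕ) (ok : Bool) (bs : List Bool)
    (hok : ok = true → bs.getLast? ≠ some false) (hn : n = 0 → bs = [])
    (h : tokensOk n ok l = true) : ∃ t, t.length = n ∧ bs.map Sum.inr ++ l = encNats t := by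
  induction l generalizing n ok bs with
  | nil =>
    obtain rfl : n = 0 := by simpa [tokensOk] using h
    exact ⟨[], rfl, by simp [hn rfl, encNats]⟩
  | cons a l ih =>
    cases n with
    | zero => simp [tokensOk] at h
    | succ n =>
      rcases a with a | a
      · simp only [tokensOk] at h
        split_ifs at h with h1
        obtain ⟨m, rfl⟩ := (exists_bits_eq_iff bs).2 (hok h1.2)
        obtain ⟨t, h2, h3⟩ := ih n true [] (by simp) (by simp) h
        refine ⟨m :: t, by simp [h2], ?_⟩
        rw [encNats_cons, ← h3, h1.1]
        rfl
      · obtain ⟨t, h2, h3⟩ := ih (n + 1) a (bs ++ [a]) (by simp) (by simp) h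
        exact ⟨t, h2, by simpa using h3⟩

lemma exists_of_parse {k : ℕ} {sp : List Sy} (l : List Sy) (n : ℕ) (ok : Bool) (bs : List Bool)
    (hok : ok = true → bs.getLast? ≠ some false) (hn : n = 0 → bs = [])
    (h : parse k n ok l = some sp) :
    ∃ t Dl t', t.length = n ∧ t'.length = k ∧ sp = .inl 7 :: encNats t' ∧
      bs.map Sum.inr ++ l = encNats t ++ (encFs Dl ++ sp) := by
  induction l generalizing n ok bs with
  | nil => cases n <;> simp [parse] at h
  | cons a l ih =>
    cases n with
    | zero =>
      obtain rfl := hn rfl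
      rcases a with a | a
      · simp only [parse] at h
        split_ifs at h with h1 h2
        · obtain ⟨t, h3, h4⟩ := exists_of_tokensOk l k true [] (by simp) (by simp) h2
          obtain rfl := Option.some.inj h
          exact ⟨[], [], t, rfl, h3, by simp [h1, ← h4], by simp [encNats, encFs]⟩
        · obtain ⟨t, Dl, t', h3, h4, h5, h6⟩ := ih _ true [] (by simp) (by simp) h
          obtain ⟨f, rfl, rfl⟩ := exists_fact h1 h3
          refine ⟨[], f :: Dl, t', rfl, h4, h5, ?_⟩
          rw [encFs_cons]
          simpa [encNats] using h6
      · simp [parse] at h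
    | succ n =>
      rcases a with a | a
      · simp only [parse] at h
        split_ifs at h with h1
        obtain ⟨m, rfl⟩ := (exists_bits_eq_iff bs).2 (hok h1.2)
        obtain ⟨t, Dl, t', h2, h3, h4, h5⟩ := ih n true [] (by simp) (by simp) h
        refine ⟨m :: t, Dl, t', by simp [h2], h3, h4, ?_⟩
        rw [encNats_cons, List.append_assoc, List.cons_append, ← h5, h1.1]
        rfl
      · obtain ⟨t, Dl, t', h2, h3, h4, h5⟩ := ih (n + 1) a (bs ++ [a]) (by simp) (by simp) h
        exact ⟨t, Dl, t', h2, h3, h4, by simpa using h5⟩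

/-! #### The tokens -/

lemma takeBits_bits (bs : List Bool) (l : List Sy) :
    takeBits (bs.map Sum.inr ++ .inl 7 :: l) = bs := by
  induction bs with
  | nil => rfl
  | cons b bs ih => simp [takeBits, ih]

lemma skipTok_bits (n : ℕ) (bs : List Bool) (l : List Sy) :
    skipTok (n + 1) (bs.map Sum.inr ++ .inl 7 :: l) = skipTok n l := by
  induction bs with
  | nil => rfl
  | cons b bs ih => simp [skipTok, ih]

lemma takeBits_skipTok (a : Fin 8) (t : List ℕ) (l : List Sy) (n v : ℕ) (h : t[n]? = some v) :
    takeBits (skipTok (n + 1) (.inl a :: (encNats t ++ l))) = Nat.bits v := by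
  rw [skipTok]
  induction t generalizing n with
  | nil => simp at h
  | cons b t ih =>
    rw [encNats_cons, List.append_assoc, List.cons_append]
    cases n with
    | zero =>
      obtain rfl : b = v := by simpa using h
      rw [skipTok, takeBits_bits]
    | succ n =>
      rw [skipTok_bits]
      exact ih n (by simpa using h)

lemma suffix_of_notMem {T : Type} {a : T} {x l l' : List T} (ha : a ∉ l) (hx : x.head? = some a)
    (h : x <:+ l ++ l') : x <:+ l' := by
  induction l with
  | nil => exact h
  | cons b l ih =>
    rcases List.suffix_cons_iff.1 h with rfl | h
    · simp at hx ha
      exact absurd hx.symm ha.1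
    · exact ih (fun h' => ha (List.mem_cons_of_mem _ h')) h

lemma notMem_encNats {a : Fin 8} (ha : a ≠ 7) (t : List ℕ) : .inl a ∉ encNats t := by
  simp [encNats, encNat, ha]

lemma exists_of_suffix {a : Fin 8} (ha : a ≠ 7) {x : List Sy} (hx : x.head? = some (.inl a))
    {Dl : List F14} {t : List ℕ} (h : x <:+ encFs Dl ++ .inl 7 :: encNats t) :
    ∃ f ∈ Dl, rel f = a ∧ ∃ l, x = .inl (rel f) :: (encNats (args f) ++ l) := by
  induction Dl with
  | nil =>
    have := suffix_of_notMem (l := .inl 7 :: encNats t) (l' := []) (by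
      simp [ha, notMem_encNats ha]) hx
      (by simpa [encFs] using h)
    rw [List.suffix_nil.1 this] at hx
    simp at hx
  | cons f Dl ih =>
    rw [encFs_cons, List.cons_append, List.suffix_cons_iff] at h
    rcases h with rfl | h
    · refine ⟨f, by simp, by simpa using hx, _, by rw [List.append_assoc]⟩
    · rw [List.append_assoc] at h
      obtain ⟨g, h1, h2⟩ := ih (suffix_of_notMem (notMem_encNats ha _) hx h)
      exact ⟨g, List.mem_cons_of_mem _ h1, h2⟩

lemma exists_suffix {f : F14} {Dl : List F14} (hf : f ∈ Dl) (s : List Sy) :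
    ∃ l, .inl (rel f) :: (encNats (args f) ++ l) <:+ encFs Dl ++ s := by
  obtain ⟨l, l', rfl⟩ := List.append_of_mem hf
  refine ⟨encFs l' ++ s, encFs l, ?_⟩
  have : encFs (l ++ f :: l') = encFs l ++ encFs (f :: l') := by simp [encFs]
  rw [this, encFs_cons]
  simp

/-! #### The search for a witness -/

section witness
variable {k m : ℕ}

/-- The sources of the tokens that are compared: the arguments of the facts, and the answers. -/
def tokSrc : (Fin m × Fin 3) ⊕ Fin k → Option (Fin m)
  | .inl (j, _) => some j
  | .inr _ => none

/-- The number of tokens to be skipped. -/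
def tokCnt : (Fin m × Fin 3) ⊕ Fin k → Fin (k + 4)
  | .inl (_, a) => ⟨a + 1, by omega⟩
  | .inr i => ⟨i + 1, by omega⟩

/-- The number denoted by a token. -/
def tokVal (f : Fin m → Option F14) (t : Fin k → ℕ) : (Fin m × Fin 3) ⊕ Fin k → Option ℕ
  | .inl (j, a) => (f j).bind fun g => (args g)[a.1]?
  | .inr i => some (t i)

/-- The instance given by some facts. -/
def factsOf (f : Fin m → Option F14) : Interp σ14 ℕ := {g | ∃ j F, f j = some F ∧ g = F.toAtm}

/-- Facts with given relation symbols and given equalities between arguments imply a certain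
answer. -/
def GoodFor (q : CQ σ14 k) (rels : Fin m → Option Sy)
    (eq : (Fin m × Fin 3) ⊕ Fin k → (Fin m × Fin 3) ⊕ Fin k → Bool) : Prop :=
  ∃ (f : Fin m → Option F14) (t : Fin k → ℕ), (∀ i, t i ∈ (factsOf f).dom) ∧
    CertainCQ O14 (factsOf f) q t ∧ (∀ j g, f j = some g → rels j = some (.inl (rel g))) ∧
    ∀ i i' v, tokVal f t i = some v → tokVal f t i' = some v → eq i i' = true

lemma takeBits_token {f : Fin m → Option F14} {t : Fin k → ℕ} {x : Fin m → List Sy}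
    (hx : ∀ j g, f j = some g → ∃ l, x j = .inl (rel g) :: (encNats (args g) ++ l))
    (i : (Fin m × Fin 3) ⊕ Fin k) (v : ℕ) (h : tokVal f t i = some v) :
    takeBits (skipTok (tokCnt i)
      (source (.inl 7 :: encNats ((List.finRange k).map t)) x (tokSrc i))) = Nat.bits v := by
  rcases i with ⟨j, a⟩ | i
  · obtain ⟨g, h1, h2⟩ := Option.bind_eq_some_iff.1 h
    obtain ⟨l, hl⟩ := hx j g h1
    simp only [source, tokSrc, hl]
    exact takeBits_skipTok _ _ _ _ _ h2
  · have := takeBits_skipTok 7 ((List.finRange k).map t) [] i v (by simpa [tokVal] using h)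
    rwa [List.append_nil] at this

lemma IsHom.map_dom {V W : Type} {A : Interp σ14 V} {B : Interp σ14 W} {h : V → W}
    (hh : IsHom A B h) {v : V} (hv : v ∈ A.dom) : h v ∈ B.dom := by
  obtain ⟨g, hg, i, rfl⟩ := hv
  exact ⟨_, hh g hg, i, rfl⟩

lemma accept_iff {q : CQ σ14 k}
    (hm : ∀ (V : Type) (D : Interp σ14 V) (a : Fin k → V), (∀ i, a i ∈ D.dom) →
      CertainCQ O14 D q a → ∃ f : Fin m → Option (Atm σ14 V), (∀ j g, f j = some g → g ∈ D) ∧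
        (∀ i, a i ∈ Interp.dom {g | ∃ j, f j = some g}) ∧
        CertainCQ O14 {g | ∃ j, f j = some g} q a) (Dl : List F14) (t : Fin k → ℕ) :
    (∃ x : Fin m → List Sy,
      (∀ j, x j <:+ encFs Dl ++ .inl 7 :: encNats ((List.finRange k).map t)) ∧
      Accept tokSrc tokCnt (GoodFor q) (.inl 7 :: encNats ((List.finRange k).map t)) x) ↔
    (∀ i, t i ∈ (toInterp14 Dl).dom) ∧ CertainCQ O14 (toInterp14 Dl) q t := by
  constructor
  · rintro ⟨x, hx, f, t', h1, h2, h3, h4⟩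
    have hg : ∀ j, ∃ F : Option F14, ∀ g, f j = some g → ∃ g' ∈ Dl, F = some g' ∧
        rel g' = rel g ∧ ∃ l, x j = .inl (rel g') :: (encNats (args g') ++ l) := by
      intro j
      cases hj : f j with
      | none => exact ⟨none, by simp⟩
      | some g =>
        obtain ⟨g', h5, h6⟩ := exists_of_suffix (rel_ne g) (h3 j g hj) (hx j)
        exact ⟨some g', by rintro _ ⟨⟩; exact ⟨g', h5, rfl, h6⟩⟩
    choose f' hf' using hg
    obtain ⟨f'', hf''⟩ : ∃ f'' : Fin m → Option F14, ∀ j, f'' j = (f j).bind fun _ => f' j :=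
      ⟨_, fun _ => rfl⟩
    have hx' : ∀ j g, f'' j = some g →
        ∃ l, x j = .inl (rel g) :: (encNats (args g) ++ l) := by
      intro j g hj
      rw [hf'', Option.bind_eq_some_iff] at hj
      obtain ⟨g₀, h5, h6⟩ := hj
      obtain ⟨g', -, h7, -, h8⟩ := hf' j g₀ h5
      obtain rfl : g = g' := Option.some.inj (h6.symm.trans h7)
      exact h8
    have hval : ∀ i v, tokVal f t' i = some v → ∃ v', tokVal f'' t i = some v' := by
      rintro (⟨j, a⟩ | i) v h
      · obtain ⟨g, h5, h6⟩ := Option.bind_eq_some_iff.1 h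
        obtain ⟨g', -, h7, h8, -⟩ := hf' j g h5
        obtain ⟨h9, -⟩ := List.getElem?_eq_some_iff.1 h6
        rw [length_args, ← h8, ← length_args] at h9
        exact ⟨(args g')[a.1], by simp [tokVal, hf'', h5, h7, h9]⟩
      · exact ⟨t i, rfl⟩
    have hρ : ∀ v, ∃ v', ∀ i, tokVal f t' i = some v → tokVal f'' t i = some v' := by
      intro v
      by_cases hv : ∃ i, tokVal f t' i = some v
      · obtain ⟨i, hi⟩ := hv
        obtain ⟨v', hv'⟩ := hval i v hi
        refine ⟨v', fun i' hi' => ?_⟩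
        obtain ⟨v'', hv''⟩ := hval i' v hi'
        have h5 := of_decide_eq_true (h4 i i' v hi hi')
        rw [takeBits_token hx' i v' hv', takeBits_token hx' i' v'' hv''] at h5
        rw [hv'', bits_injective h5]
      · exact ⟨0, fun i hi => absurd ⟨i, hi⟩ hv⟩
    choose ρ hρ using hρ
    have hhom : IsHom (factsOf f) (toInterp14 Dl) ρ := by
      rw [isHom_iff]
      rintro _ ⟨j, g, hj, rfl⟩
      obtain ⟨g', h5, h6, h7, -⟩ := hf' j g hj
      refine ⟨g', h5, mapAtm_toAtm h7 (List.ext_getElem? fun a => ?_)⟩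
      rw [List.getElem?_map]
      have hlen : (args g').length = (args g).length := by rw [length_args, h7, length_args]
      rcases lt_or_ge a (args g).length with ha | ha
      · have ha3 : a < 3 := by
          have : arity (rel g) < 4 := arity_lt _
          rw [length_args] at ha
          omega
        have h8 := hρ (args g)[a] (.inl (j, ⟨a, ha3⟩)) (by simp [tokVal, hj, ha])
        simpa [tokVal, hf'', hj, h6, ha] using h8
      · rw [List.getElem?_eq_none ha, List.getElem?_eq_none (hlen.trans_le ha)]
        rfl
    have ht : t = ρ ∘ t' := funext fun i => Option.some.inj (hρ (t' i) (.inr i) rfl)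
    subst ht
    exact ⟨fun i => IsHom.map_dom hhom (h1 i), CertainCQ.map hhom h2⟩
  · rintro ⟨h1, h2⟩
    obtain ⟨f, h3, h4, h5⟩ := hm _ _ t h1 h2
    have hg : ∀ j, ∃ F : Option F14, F.map F14.toAtm = f j ∧ ∀ g, F = some g → g ∈ Dl := by
      intro j
      cases hj : f j with
      | none => exact ⟨none, by simp⟩
      | some g =>
        obtain ⟨g', h5, rfl⟩ := h3 j g hj
        exact ⟨some g', by simpa using h5⟩
    choose f' hf' hmem using hg
    have hD : {g | ∃ j, f j = some g} = factsOf f' := by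
      ext g
      simp only [factsOf, Set.mem_ofPred_eq, ← hf', Option.map_eq_some_iff, eq_comm]
    rw [hD] at h4 h5
    have hx : ∀ j, ∃ x : List Sy,
        x <:+ encFs Dl ++ .inl 7 :: encNats ((List.finRange k).map t) ∧
        ∀ g, f' j = some g → ∃ l, x = .inl (rel g) :: (encNats (args g) ++ l) := by
      intro j
      cases hj : f' j with
      | none => exact ⟨[], List.nil_suffix, by simp⟩
      | some g =>
        obtain ⟨l, hl⟩ := exists_suffix (hmem j g hj)
          (.inl 7 :: encNats ((List.finRange k).map t))
        exact ⟨_, hl, by rintro _ ⟨⟩; exact ⟨l, rfl⟩⟩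
    choose x hx hx' using hx
    refine ⟨x, hx, f', t, h4, h5, fun j g hj => ?_, fun i i' v hi hi' => ?_⟩
    · obtain ⟨l, hl⟩ := hx' j g hj
      change (x j).head? = _
      rw [hl]
      rfl
    · exact decide_eq_true ((takeBits_token hx' i v hi).trans (takeBits_token hx' i' v hi').symm)

/-- Query evaluation with respect to the wheel ontology is in PTime. -/
theorem inP_evalLang (q : CQ σ14 k) : InP (EvalLang14 q) := by
  obtain ⟨m, hm⟩ := exists_small_witness q
  convert inP_search k tokSrc tokCnt (GoodFor (m := m) q) using 1
  ext w
  constructor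
  · rintro ⟨Dl, t, rfl, h⟩
    rw [encInput_eq]
    refine ⟨.inl 7 :: encNats ((List.finRange k).map t), ?_, (accept_iff hm Dl t).2 h⟩
    simpa using parse_encInput Dl ((List.finRange k).map t)
  · rintro ⟨sp, hsp, h⟩
    obtain ⟨t₀, Dl, t, h1, rfl, rfl, h2⟩ := exists_of_parse w 0 true [] (by simp) (by simp) hsp
    obtain rfl := List.length_eq_zero_iff.1 h1
    obtain rfl : w = encFs Dl ++ .inl 7 :: encNats t := h2
    have ht : (List.finRange t.length).map t.get = t := by simp
    refine ⟨Dl, t.get, by rw [encInput_eq, ht], (accept_iff hm Dl t.get).1 ?_⟩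
    rwa [ht]

end witness

end Wheel

/-- There is a uGF(2) ontology `O` (the wheel ontology above, using three variables) that
is materializable but does not admit hom-universal models: for the instance `D = {C(a)}`
there is no model `B` of `O` and `D` with a homomorphism preserving `dom(D)` into every
model of `O` and `D`; yet every instance consistent with `O` has a CQ-materialization, and
CQ-evaluation w.r.t. `O` is in PTime. -/
theorem stmt14 :
    (∀ (V : Type) (D : Interp σ14 V), Consistent O14 D →
      ∃ (Wc : Type) (ι : V → Wc) (B : Interp σ14 Wc), IsCQMat14 D ι B) ∧
    ¬ (∃ (Wc : Type) (ι : Unit → Wc) (B : Interp σ14 Wc), IsMod O14 D14 ι B ∧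
        ∀ (Wc' : Type) (ι' : Unit → Wc') (B' : Interp σ14 Wc'), IsMod O14 D14 ι' B' →
          ∃ g : Wc → Wc', IsHom B B' g ∧ g ∘ ι = ι') ∧
    (∀ (k : ℕ) (q : CQ σ14 k), InP (EvalLang14 q)) := by
  refine ⟨fun V D _ => ⟨Wheel.Elt V, Wheel.root, Wheel.mat D, Wheel.mat_isMod,
    fun k q a _ => Wheel.cqAns_mat_iff q a⟩, Wheel.no_homUniversal,
    fun k q => Wheel.inP_evalLang q⟩
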